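/- arXiv:1511.06337 — 2 statements merged into one kernel-verified Lean document; each statement's English description precedes it below -/
import Mathlib

section
/- Let γ be a W→O→W or W↑O↑W shape and let n be the common size of its key ribbons. Let c be the infinite one-column shape (one box in every row, all in one column) and let d be the infinite one-row shape. Then no connected ribbon of size n can be taken out on the left of the infinite shape c ∘_W γ, none can be taken out on the right of c ∘_W γ, none can be taken out on the left of d ∘_W γ, and none can be taken out on the right of d ∘_W γ. -/
open scoped Classical

noncomputable section

/-- A box in the plane: `(row, column)`; rows increase downward, columns rightward. -/
abbrev Box : Type := ℤ × ℤ

/-- Translate a finite set of boxes by the vector `t`. -/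
def translateS (t : Box) (S : Finset Box) : Finset Box :=
  S.image (fun b => t + b)

/-- 180-degree rotation of a finite set of boxes. -/
def rot180 (S : Finset Box) : Finset Box :=
  S.image (fun b => ((-b.1, -b.2) : Box))

/-- The diagonal of a box: column index minus row index. -/
def diagB (b : Box) : ℤ := b.2 - b.1

/-- `S` is the Young diagram of a partition: a down-left closed set of boxes with
nonnegative coordinates, anchored at the origin region. -/
def IsYoungDiagram (S : Finset Box) : Prop :=
  ∀ b ∈ S, 0 ≤ b.1 ∧ 0 ≤ b.2 ∧
    ∀ b' : Box, 0 ≤ b'.1 → 0 ≤ b'.2 → b'.1 ≤ b.1 → b'.2 ≤ b.2 → b' ∈ S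

/-- `S` is a skew shape `λ / μ` (aligned at the top-left corner). -/
def IsSkewShape (S : Finset Box) : Prop :=
  ∃ mu lam : Finset Box, IsYoungDiagram mu ∧ IsYoungDiagram lam ∧ mu ⊆ lam ∧ S = lam \ mu

/-- A shape: a translate of a skew shape (possibly disconnected). -/
def IsShape (S : Finset Box) : Prop :=
  ∃ (t : Box) (T : Finset Box), IsSkewShape T ∧ S = translateS t T

/-- Two boxes are adjacent when they share an edge. -/
def AdjB (x y : Box) : Prop :=
  (x.1 = y.1 ∧ (x.2 = y.2 + 1 ∨ y.2 = x.2 + 1)) ∨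
  (x.2 = y.2 ∧ (x.1 = y.1 + 1 ∨ y.1 = x.1 + 1))

/-- A finite set of boxes is connected (and nonempty) via shared edges. -/
def IsConnectedShape (S : Finset Box) : Prop :=
  S.Nonempty ∧ ∀ x ∈ S, ∀ y ∈ S,
    Relation.ReflTransGen (fun a b => a ∈ S ∧ b ∈ S ∧ AdjB a b) x y

/-- `S` contains no 2×2 block of boxes. -/
def NoTwoByTwo (S : Finset Box) : Prop :=
  ∀ r c : ℤ, ¬ (((r, c) : Box) ∈ S ∧ ((r, c + 1) : Box) ∈ S ∧
      ((r + 1, c) : Box) ∈ S ∧ ((r + 1, c + 1) : Box) ∈ S)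

/-- A ribbon: a shape containing no 2×2 block of boxes. -/
def IsRibbon (S : Finset Box) : Prop := IsShape S ∧ NoTwoByTwo S

/-- Number of nonempty rows of a finite set of boxes. -/
def rowsOf (S : Finset Box) : ℕ := (S.image Prod.fst).card

/-- Number of nonempty columns of a finite set of boxes. -/
def colsOf (S : Finset Box) : ℕ := (S.image Prod.snd).card

/-- The concrete set of boxes `T` witnesses taking out on the left of `S`:
there is a presentation `S = t + (λ \ μ)` and a partition `η` with `μ ⊆ η ⊆ λ`
such that `T = t + (η \ μ)`. -/
def TakenOutLeftAt (T S : Finset Box) : Prop :=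
  ∃ (mu eta lam : Finset Box) (t : Box),
    IsYoungDiagram mu ∧ IsYoungDiagram eta ∧ IsYoungDiagram lam ∧
    mu ⊆ eta ∧ eta ⊆ lam ∧
    S = translateS t (lam \ mu) ∧ T = translateS t (eta \ mu)

/-- The concrete set of boxes `T` witnesses taking out on the right of `S`. -/
def TakenOutRightAt (T S : Finset Box) : Prop :=
  ∃ (mu eta lam : Finset Box) (t : Box),
    IsYoungDiagram mu ∧ IsYoungDiagram eta ∧ IsYoungDiagram lam ∧
    mu ⊆ eta ∧ eta ⊆ lam ∧
    S = translateS t (lam \ mu) ∧ T = translateS t (lam \ eta)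

/-- The shape `δ` (up to translation) can be taken out on the left of `S`. -/
def TakenOutLeft (δ S : Finset Box) : Prop :=
  ∃ T : Finset Box, (∃ u, T = translateS u δ) ∧ TakenOutLeftAt T S

/-- The shape `δ` (up to translation) can be taken out on the right of `S`. -/
def TakenOutRight (δ S : Finset Box) : Prop :=
  ∃ T : Finset Box, (∃ u, T = translateS u δ) ∧ TakenOutRightAt T S

/-- The skew Schur polynomial of the set of boxes `S` in `m` variables: the sum over
semistandard fillings of `S` with entries in `{1, …, m}` (encoded as `Fin m`) of the
corresponding monomials.  Entries weakly increase left-to-right along rows and strictly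
increase down columns. -/
def schurPoly (S : Finset Box) (m : ℕ) : MvPolynomial (Fin m) ℚ :=
  ∑ g ∈ Finset.univ.filter (fun g : (↥S → Fin m) =>
      (∀ b b' : ↥S, (b : Box).1 = (b' : Box).1 → (b : Box).2 ≤ (b' : Box).2 → g b ≤ g b') ∧
      (∀ b b' : ↥S, (b : Box).2 = (b' : Box).2 → (b : Box).1 < (b' : Box).1 → g b < g b')),
    ∏ b : ↥S, MvPolynomial.X (g b)

/-- Two sets of boxes are Schur-equivalent when their skew Schur polynomials agree in
every number of variables. -/
def SchurEquiv (S T : Finset Box) : Prop := ∀ m : ℕ, schurPoly S m = schurPoly T m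

/-- `b` is the northeasternmost box of `S`: minimal row, and maximal column in that row. -/
def IsNEBox (S : Finset Box) (b : Box) : Prop :=
  b ∈ S ∧ (∀ b' ∈ S, b.1 ≤ b'.1) ∧ (∀ b' ∈ S, b'.1 = b.1 → b'.2 ≤ b.2)

/-- `b` is the southwesternmost box of `S`: maximal row, and minimal column in that row. -/
def IsSWBox (S : Finset Box) (b : Box) : Prop :=
  b ∈ S ∧ (∀ b' ∈ S, b'.1 ≤ b.1) ∧ (∀ b' ∈ S, b'.1 = b.1 → b.2 ≤ b'.2)

/-- `Wc` is a copy of `W` lying in the top of `α`: a connected subdiagram of `α`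
containing the northeasternmost box of `α`. -/
def LiesInTopAt (W α Wc : Finset Box) : Prop :=
  (∃ t, Wc = translateS t W) ∧ Wc ⊆ α ∧ IsConnectedShape Wc ∧
  ∃ b, IsNEBox α b ∧ b ∈ Wc

/-- `Wc` is a copy of `W` lying in the bottom of `α`: a connected subdiagram of `α`
containing the southwesternmost box of `α`. -/
def LiesInBottomAt (W α Wc : Finset Box) : Prop :=
  (∃ t, Wc = translateS t W) ∧ Wc ⊆ α ∧ IsConnectedShape Wc ∧
  ∃ b, IsSWBox α b ∧ b ∈ Wc

/-- The set of diagonals occupied by `S`. -/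
def DiagSet (S : Finset Box) : Finset ℤ := S.image diagB

/-- `γ` is a `W → O → W` shape (when `right = true`) or a `W ↑ O ↑ W` shape (when
`right = false`), with lower copy `Wlow` and upper copy `Wup` of `W`, where
`translateS v Wlow = Wup`.  The conditions are those of McNamara–van Willigenburg:
`W` lies in the bottom and the top of `γ`; removing either copy of `W` leaves a
connected shape; removing both copies leaves `O`; at least one diagonal lies strictly
between the two copies of `W`; the copies of `W` attach to `O` horizontally
(`right = true`) or vertically (`right = false`); and `W` is maximal. -/
def IsWOW (right : Bool) (γ W O Wlow Wup : Finset Box) (v : Box) : Prop :=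
  IsShape γ ∧ IsShape W ∧
  LiesInBottomAt W γ Wlow ∧ LiesInTopAt W γ Wup ∧
  translateS v Wlow = Wup ∧
  IsShape (γ \ Wup) ∧ IsConnectedShape (γ \ Wup) ∧
  IsShape (γ \ Wlow) ∧ IsConnectedShape (γ \ Wlow) ∧
  O = γ \ (Wlow ∪ Wup) ∧
  (∃ k : ℤ, (∀ b ∈ Wlow, diagB b < k) ∧ (∀ b ∈ Wup, k < diagB b)) ∧
  (if right then
      (∃ b, IsSWBox O b ∧ ((b.1, b.2 - 1) : Box) ∈ Wlow) ∧
      (∃ b, IsNEBox O b ∧ ((b.1, b.2 + 1) : Box) ∈ Wup)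
    else
      (∃ b, IsSWBox O b ∧ ((b.1 + 1, b.2) : Box) ∈ Wlow) ∧
      (∃ b, IsNEBox O b ∧ ((b.1 - 1, b.2) : Box) ∈ Wup)) ∧
  (∀ W' Wlow' Wup' : Finset Box,
      LiesInBottomAt W' γ Wlow' → LiesInTopAt W' γ Wup' →
      IsConnectedShape (γ \ Wup') → IsConnectedShape (γ \ Wlow') →
      Wlow ⊆ Wlow' → DiagSet Wlow' = DiagSet Wlow → Wlow' = Wlow)

/-- The upper-left boundary ribbon of `A`: boxes with no box of `A` diagonally
to the northwest. -/
def ulBoundary (A : Finset Box) : Finset Box :=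
  A.filter (fun b => ((b.1 - 1, b.2 - 1) : Box) ∉ A)

/-- The bottom-right boundary ribbon of `A`: boxes with no box of `A` diagonally
to the southeast. -/
def brBoundary (A : Finset Box) : Finset Box :=
  A.filter (fun b => ((b.1 + 1, b.2 + 1) : Box) ∉ A)

/-- The top key ribbon of a `WOW` shape `γ` (with `O = γ` minus the two copies of `W`
and with shift `v` from the lower to the upper copy of `W`), as a subset of the
amalgamation `γ ⨿_W γ = γ ∪ translateS v γ`, in the coordinates in which the lower
copy of `γ` is `γ` itself.  Positions along the upper-left boundary ribbon are
measured by diagonals. -/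
def topKeyRibbon (right : Bool) (γ O : Finset Box) (v : Box) : Finset Box :=
  let A := γ ∪ translateS v γ
  let U := ulBoundary A
  if right then
    U.filter (fun b => (∀ b' ∈ U ∩ O, diagB b' < diagB b) ∧
      (∃ b' ∈ U ∩ translateS v O, diagB b ≤ diagB b'))
  else
    U.filter (fun b => (∃ b' ∈ U ∩ O, diagB b' ≤ diagB b) ∧
      (∀ b' ∈ U ∩ translateS v O, diagB b < diagB b'))

/-- The bottom key ribbon of a `WOW` shape `γ`, along the bottom-right boundary
ribbon of `γ ⨿_W γ`. -/
def bottomKeyRibbon (right : Bool) (γ O : Finset Box) (v : Box) : Finset Box :=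
  let A := γ ∪ translateS v γ
  let D := brBoundary A
  if right then
    D.filter (fun b => (∃ b' ∈ D ∩ O, diagB b' ≤ diagB b) ∧
      (∀ b' ∈ D ∩ translateS v O, diagB b < diagB b'))
  else
    D.filter (fun b => (∀ b' ∈ D ∩ O, diagB b' < diagB b) ∧
      (∃ b' ∈ D ∩ translateS v O, diagB b ≤ diagB b'))

/-- The offset of the copy of `γ` corresponding to a box immediately to the east:
amalgamation for `W→O→W` shapes, shifted amalgamation for `W↑O↑W` shapes. -/
def eVec (right : Bool) (v : Box) : Box := if right then v else v + ((1, 1) : Box)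

/-- The offset of the copy of `γ` corresponding to a box immediately to the north:
shifted amalgamation for `W→O→W` shapes, amalgamation for `W↑O↑W` shapes. -/
def nVec (right : Bool) (v : Box) : Box := if right then v + ((-1, -1) : Box) else v

/-- The offset of the copy of `γ` corresponding to the box `b = (r, c)` of `α` in the
composition `α ∘_W γ`: each step east adds `eVec`, each step north adds `nVec`. -/
def boxOffset (right : Bool) (v : Box) (b : Box) : Box :=
  b.2 • eVec right v - b.1 • nVec right v

/-- The composition `α ∘_W γ`: one copy of `γ` per box of `α`, overlapped by
amalgamations and shifted amalgamations according to the type of `γ`. -/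
def composeWOW (right : Bool) (γ : Finset Box) (v : Box) (α : Finset Box) : Finset Box :=
  α.biUnion (fun b => translateS (boxOffset right v b) γ)

/-- `γ` has no loose end ribbons (n being the size of its key ribbons): for a
`W→O→W` shape, no ribbon of size `n` beginning (strictly smaller diagonal) to the left
of the top key ribbon can be taken out on the left of `γ`, and no ribbon of size `n`
ending (strictly larger diagonal) to the right of the bottom key ribbon can be taken out
on the right of `γ`; for a `W↑O↑W` shape, the corresponding conditions with the ends
swapped. -/
def NoLooseEndRibbons (right : Bool) (γ O : Finset Box) (v : Box) : Prop :=
  let n := (topKeyRibbon right γ O v).card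
  if right then
    (∀ T : Finset Box, IsRibbon T → T.card = n → TakenOutLeftAt T γ →
        ¬ ∃ b ∈ T, ∀ b' ∈ topKeyRibbon right γ O v, diagB b < diagB b') ∧
    (∀ T : Finset Box, IsRibbon T → T.card = n → TakenOutRightAt T γ →
        ¬ ∃ b ∈ T, ∀ b' ∈ bottomKeyRibbon right γ O v, diagB b' < diagB b)
  else
    (∀ T : Finset Box, IsRibbon T → T.card = n → TakenOutLeftAt T γ →
        ¬ ∃ b ∈ T, ∀ b' ∈ topKeyRibbon right γ O v, diagB b' < diagB b) ∧
    (∀ T : Finset Box, IsRibbon T → T.card = n → TakenOutRightAt T γ →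
        ¬ ∃ b ∈ T, ∀ b' ∈ bottomKeyRibbon right γ O v, diagB b < diagB b')

/-- The `a × b` rectangle of boxes (rows `0, …, a-1`, columns `0, …, b-1`). -/
def rectShape (a b : ℕ) : Finset Box :=
  (Finset.range a ×ˢ Finset.range b).image (fun p => (((p.1 : ℤ), (p.2 : ℤ)) : Box))

/-- The rectangle with its lower-right corner box removed. -/
def betaShape (a b : ℕ) : Finset Box :=
  rectShape a b \ {(((a : ℤ) - 1, (b : ℤ) - 1) : Box)}

/-- The truncation window `{-N, …, N} × {-N, …, N}`. -/
def truncBox (N : ℕ) : Set Box :=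
  {b : Box | -(N : ℤ) ≤ b.1 ∧ b.1 ≤ (N : ℤ) ∧ -(N : ℤ) ≤ b.2 ∧ b.2 ≤ (N : ℤ)}

/-- 180-degree rotation of a possibly infinite set of boxes. -/
def rot180Set (Λ : Set Box) : Set Box := (fun b : Box => ((-b.1, -b.2) : Box)) '' Λ

/-- The composition `α ∘_W γ` for a possibly infinite set of boxes `α`. -/
def composeWOWSet (right : Bool) (γ : Finset Box) (v : Box) (α : Set Box) : Set Box :=
  ⋃ b ∈ α, (↑(translateS (boxOffset right v b) γ) : Set Box)

/-- An embedded infinite shape: an infinite set of boxes all of whose truncations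
are shapes. -/
def IsInfiniteShape (Λ : Set Box) : Prop :=
  Λ.Infinite ∧ ∀ N : ℕ, ∃ F : Finset Box, (↑F : Set Box) = Λ ∩ truncBox N ∧ IsShape F

/-- The fixed placement `T` witnesses taking out on the left of the infinite set of
boxes `Λ`: it witnesses taking out on the left of every sufficiently large truncation. -/
def TakenOutLeftInfAt (T : Finset Box) (Λ : Set Box) : Prop :=
  ∃ N₀ : ℕ, ∀ N : ℕ, N₀ ≤ N → ∀ F : Finset Box,
    (↑F : Set Box) = Λ ∩ truncBox N → TakenOutLeftAt T F

/-- The fixed placement `T` witnesses taking out on the right of the infinite set of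
boxes `Λ`. -/
def TakenOutRightInfAt (T : Finset Box) (Λ : Set Box) : Prop :=
  ∃ N₀ : ℕ, ∀ N : ℕ, N₀ ≤ N → ∀ F : Finset Box,
    (↑F : Set Box) = Λ ∩ truncBox N → TakenOutRightAt T F

/-- The shape `δ` (up to translation) can be taken out on the left of the infinite set
of boxes `Λ`. -/
def TakenOutLeftInf (δ : Finset Box) (Λ : Set Box) : Prop :=
  ∃ T : Finset Box, (∃ u, T = translateS u δ) ∧ TakenOutLeftInfAt T Λ

/-- The shape `δ` (up to translation) can be taken out on the right of the infinite set
of boxes `Λ`. -/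
def TakenOutRightInf (δ : Finset Box) (Λ : Set Box) : Prop :=
  ∃ T : Finset Box, (∃ u, T = translateS u δ) ∧ TakenOutRightInfAt T Λ

theorem mem_translateS {t x : Box} {S : Finset Box} : x ∈ translateS t S ↔ x - t ∈ S := by
  simp only [translateS, Finset.mem_image]
  exact ⟨fun ⟨a, ha, h⟩ => by rwa [← h, add_sub_cancel_left], fun h => ⟨_, h, by abel⟩⟩

theorem add_mem_translateS {t x : Box} {S : Finset Box} : t + x ∈ translateS t S ↔ x ∈ S := by
  rw [mem_translateS, add_sub_cancel_left]

theorem mem_of_between {S : Set Box} (hS : S.OrdConnected) {x z : Box} (hx : x ∈ S) (hz : z ∈ S)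
    (y : Box) (h₁ : x.1 ≤ y.1) (h₂ : x.2 ≤ y.2) (h₃ : y.1 ≤ z.1) (h₄ : y.2 ≤ z.2) : y ∈ S :=
  hS.out hx hz ⟨⟨h₁, h₂⟩, ⟨h₃, h₄⟩⟩

theorem IsYoungDiagram.mem_of_le {S : Finset Box} (hS : IsYoungDiagram S) {b x : Box}
    (hb : b ∈ S) (h₁ : 0 ≤ x.1) (h₂ : 0 ≤ x.2) (h₃ : x.1 ≤ b.1) (h₄ : x.2 ≤ b.2) : x ∈ S :=
  (hS b hb).2.2 x h₁ h₂ h₃ h₄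

theorem ordConnected_translateS {t : Box} {S : Finset Box} (hS : (S : Set Box).OrdConnected) :
    (translateS t S : Set Box).OrdConnected := by
  refine ⟨fun x hx z hz y hy => ?_⟩
  rw [Finset.mem_coe, mem_translateS] at *
  exact hS.out hx hz ⟨sub_le_sub_right hy.1 t, sub_le_sub_right hy.2 t⟩

theorem ordConnected_sdiff {mu lam : Finset Box} (hmu : IsYoungDiagram mu)
    (hlam : IsYoungDiagram lam) : ((lam \ mu : Finset Box) : Set Box).OrdConnected := by
  refine ⟨fun x hx z hz y hy => ?_⟩
  simp only [Finset.mem_coe, Finset.mem_sdiff] at *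
  obtain ⟨hx₁, hx₂, -⟩ := hlam x hx.1
  obtain ⟨⟨h₁, h₂⟩, ⟨h₃, h₄⟩⟩ := hy
  exact ⟨hlam.mem_of_le hz.1 (hx₁.trans h₁) (hx₂.trans h₂) h₃ h₄,
    fun h => hx.2 (hmu.mem_of_le h hx₁ hx₂ h₁ h₂)⟩

theorem IsShape.ordConnected {S : Finset Box} (hS : IsShape S) : (S : Set Box).OrdConnected := by
  obtain ⟨t, _, ⟨mu, lam, hmu, hlam, -, rfl⟩, rfl⟩ := hS
  exact ordConnected_translateS (ordConnected_sdiff hmu hlam)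

theorem TakenOutLeftAt.ordConnected {T S : Finset Box} (h : TakenOutLeftAt T S) :
    (S : Set Box).OrdConnected := by
  obtain ⟨mu, eta, lam, t, hmu, -, hlam, -, -, rfl, -⟩ := h
  exact ordConnected_translateS (ordConnected_sdiff hmu hlam)

theorem TakenOutLeftAt.subset {T S : Finset Box} (h : TakenOutLeftAt T S) : T ⊆ S := by
  obtain ⟨mu, eta, lam, t, -, -, -, -, hle, rfl, rfl⟩ := h
  exact Finset.image_subset_image (Finset.sdiff_subset_sdiff hle le_rfl)

theorem TakenOutLeftAt.mem_of_le {T S : Finset Box} (h : TakenOutLeftAt T S) {x y : Box}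
    (hx : x ∈ S) (hy : y ∈ T) (hxy : x ≤ y) : x ∈ T := by
  obtain ⟨mu, eta, lam, t, -, heta, hlam, -, -, rfl, rfl⟩ := h
  rw [mem_translateS, Finset.mem_sdiff] at *
  obtain ⟨hx₁, hx₂, -⟩ := hlam _ hx.1
  have h := sub_le_sub_right hxy t
  exact ⟨heta.mem_of_le hy.1 hx₁ hx₂ h.1 h.2, hx.2⟩

theorem TakenOutRightAt.ordConnected {T S : Finset Box} (h : TakenOutRightAt T S) :
    (S : Set Box).OrdConnected := by
  obtain ⟨mu, eta, lam, t, hmu, -, hlam, -, -, rfl, -⟩ := h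
  exact ordConnected_translateS (ordConnected_sdiff hmu hlam)

theorem TakenOutRightAt.subset {T S : Finset Box} (h : TakenOutRightAt T S) : T ⊆ S := by
  obtain ⟨mu, eta, lam, t, -, -, -, hle, -, rfl, rfl⟩ := h
  exact Finset.image_subset_image (Finset.sdiff_subset_sdiff le_rfl hle)

theorem TakenOutRightAt.mem_of_le {T S : Finset Box} (h : TakenOutRightAt T S) {x y : Box}
    (hx : x ∈ S) (hy : y ∈ T) (hxy : y ≤ x) : x ∈ T := by
  obtain ⟨mu, eta, lam, t, -, heta, hlam, -, -, rfl, rfl⟩ := h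
  rw [mem_translateS, Finset.mem_sdiff] at *
  obtain ⟨hy₁, hy₂, -⟩ := hlam _ hy.1
  have h := sub_le_sub_right hxy t
  exact ⟨hx.1, fun hx' => hy.2 (heta.mem_of_le hx' hy₁ hy₂ h.1 h.2)⟩

/-- `S` has a pair of adjacent boxes on the diagonals `t` and `t + 1`. -/
def LinkedAt (S : Set Box) (t : ℤ) : Prop :=
  ∃ u ∈ S, ∃ w ∈ S, diagB u = t ∧ diagB w = t + 1 ∧ w.1 ≤ u.1 ∧ u.2 ≤ w.2

/-- Any two consecutive diagonals within the diagonal range of `S` are joined by an edge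
of `S`. -/
def DiagLinked (S : Set Box) : Prop :=
  ∀ x ∈ S, ∀ y ∈ S, ∀ t : ℤ, diagB x ≤ t → t < diagB y → LinkedAt S t

theorem LinkedAt.mono {S S' : Set Box} {t : ℤ} (h : LinkedAt S t) (hS : S ⊆ S') :
    LinkedAt S' t := by
  obtain ⟨u, hu, u', hu', h⟩ := h
  exact ⟨u, hS hu, u', hS hu', h⟩

theorem IsConnectedShape.diagLinked {S : Finset Box} (hS : IsConnectedShape S) :
    DiagLinked (S : Set Box) := by
  intro x hx y hy t hxt hty
  have hpath := hS.2 x hx y hy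
  clear hy
  induction hpath with
  | refl => omega
  | @tail c d _ hcd ih =>
    obtain ⟨hc, hd, hadj⟩ := hcd
    rcases lt_or_ge t (diagB c) with h | h
    · exact ih h
    · refine ⟨c, hc, d, hd, ?_⟩
      simp only [AdjB, diagB] at *
      omega

theorem DiagLinked.exists_mem {S : Set Box} (hS : DiagLinked S) {x y : Box} (hx : x ∈ S)
    (hy : y ∈ S) {t : ℤ} (hxt : diagB x ≤ t) (hty : t ≤ diagB y) : ∃ z ∈ S, diagB z = t := by
  rcases hty.lt_or_eq with h | h
  · obtain ⟨u, hu, -, -, h, -⟩ := hS x hx y hy t hxt h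
    exact ⟨u, hu, h⟩
  · exact ⟨y, hy, h.symm⟩

theorem LinkedAt.swap {S : Set Box} {t : ℤ} (hS : LinkedAt S t) :
    LinkedAt (Prod.swap ⁻¹' S) (-t - 1) := by
  obtain ⟨u, hu, u', hu', h⟩ := hS
  refine ⟨u'.swap, by simpa using hu', u.swap, by simpa using hu, ?_⟩
  simp only [diagB, Prod.fst_swap, Prod.snd_swap] at *
  omega

theorem DiagLinked.swap {S : Set Box} (hS : DiagLinked S) : DiagLinked (Prod.swap ⁻¹' S) := by
  intro x hx y hy t hxt hty
  have h := hS _ hy _ hx (-t - 1) (by simp only [diagB, Prod.fst_swap, Prod.snd_swap] at *; omega)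
    (by simp only [diagB, Prod.fst_swap, Prod.snd_swap] at *; omega)
  simpa using h.swap

theorem ordConnected_swap {S : Set Box} (hS : S.OrdConnected) :
    (Prod.swap ⁻¹' S : Set Box).OrdConnected :=
  ⟨fun _ hx _ hz _ hy => mem_of_between hS hx hz _ hy.1.2 hy.1.1 hy.2.2 hy.2.1⟩

/-- If a box of `W` lies immediately to the west of the box `s` of `G`, then on the diagonals
weakly to the east of `s` all boxes of `W` lie northwest of all boxes of `G`. -/
theorem lt_of_west_neighbor {W G : Set Box} (hW : W.OrdConnected) (hG : G.OrdConnected)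
    (hWl : DiagLinked W) (hGl : DiagLinked G) (hWG : Disjoint W G) {s : Box} (hs : s ∈ G)
    (hsW : ((s.1, s.2 - 1) : Box) ∈ W) {x w : Box} (hx : x ∈ G) (hw : w ∈ W)
    (hsx : diagB s ≤ diagB x) (hxw : diagB x = diagB w) : w.1 < x.1 := by
  have hdisj : ∀ b, b ∈ W → b ∈ G → False := fun b h h' => Set.disjoint_left.1 hWG h h'
  suffices key : ∀ t, diagB s ≤ t → ∀ x ∈ G, ∀ w ∈ W, diagB x = t → diagB w = t → w.1 < x.1 from
    key _ hsx x hx w hw rfl hxw.symm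
  clear hx hw hsx hxw x w
  intro t ht
  induction t, ht using Int.leInduction with
  | base =>
    intro x hx w hw hxt hwt
    by_contra! hlt
    simp only [diagB] at hxt hwt
    rcases le_or_gt s.1 w.1 with h | h
    · exact hdisj s (mem_of_between hW hsW hw s (by simp) (by simp) h (by omega)) hs
    · exact hdisj w hw (mem_of_between hG hx hs w hlt (by omega) h.le (by omega))
  | succ t ht ih =>
    intro x hx w hw hxt hwt
    by_contra! hlt
    obtain ⟨w₁, hw₁, w₂, hw₂, hw⟩ := hWl _ hsW w hw t (by simp only [diagB] at *; omega) (by omega)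
    obtain ⟨g₁, hg₁, g₂, hg₂, hg⟩ := hGl s hs x hx t ht (by omega)
    have h₁ := ih g₁ hg₁ w₁ hw₁ hg.1 hw.1
    simp only [diagB] at *
    rcases le_or_gt w.1 g₂.1 with h | h
    · exact hdisj w ‹_› (mem_of_between hG hx hg₂ w hlt (by omega) h (by omega))
    · exact hdisj g₂ (mem_of_between hW hw₂ ‹w ∈ W› g₂ (by omega) (by omega) h.le (by omega)) hg₂

/-- For a shape of horizontal type with lower copy `Wl` and upper copy `Wu` of `W`, some box of
the middle part on the same diagonal as `b` lies on the upper-left boundary, both of `γ` and of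
its translate by `v`. -/
theorem exists_boundary_box {γ Wl Wu : Set Box} {v s b : Box} (hfin : γ.Finite)
    (hγ : γ.OrdConnected) (hWl : Wl.OrdConnected) (hWu : Wu.OrdConnected)
    (hG : (γ \ Wl).OrdConnected) (hlW : DiagLinked Wl) (hlG : DiagLinked (γ \ Wl))
    (hlγ : Wl ⊆ γ) (huγ : Wu ⊆ γ) (htr : ∀ x, x ∈ Wu ↔ x - v ∈ Wl)
    (hs : s ∈ γ \ Wl) (hsW : ((s.1, s.2 - 1) : Box) ∈ Wl)
    (hb : b ∈ γ) (hbu : b ∉ Wu) (hbW : ((b.1, b.2 + 1) : Box) ∈ Wu)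
    (hbl : ∀ x ∈ Wl, diagB x < diagB b)
    (hmin : ∀ x ∈ γ \ Wl, diagB s ≤ diagB x) :
    ∃ o ∈ γ \ (Wl ∪ Wu), diagB o = diagB b ∧ ((o.1 - 1, o.2 - 1) : Box) ∉ γ ∧
      ((o.1 - 1, o.2 - 1) : Box) - v ∉ γ := by
  obtain ⟨o, ⟨hoγ, hob⟩, homin⟩ := Set.exists_min_image {x ∈ γ | diagB x = diagB b} Prod.fst
    (hfin.subset (Set.sep_subset _ _)) ⟨b, hb, rfl⟩
  have hle : o.1 ≤ b.1 := homin b ⟨hb, rfl⟩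
  have hnw : ((o.1 - 1, o.2 - 1) : Box) ∉ γ := fun h => by
    have := homin _ ⟨h, by simp only [diagB] at *; omega⟩
    simp only at this
    omega
  have hou : o ∉ Wu := fun h => hbu (mem_of_between hWu h hbW b hle
    (by simp only [diagB] at *; omega) le_rfl (by simp))
  refine ⟨o, ⟨hoγ, ?_⟩, hob, hnw, fun hq => ?_⟩
  · rintro (h | h)
    · exact (hbl o h).ne hob
    · exact hou h
  have hqG : ((o.1 - 1, o.2 - 1) : Box) - v ∈ γ \ Wl :=
    ⟨hq, fun h => hnw (huγ ((htr _).2 h))⟩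
  have hw : ((b.1, b.2 + 1) : Box) - v ∈ Wl := (htr _).1 hbW
  have hq₁ := hmin _ hqG
  have hdisj : Disjoint Wl (γ \ Wl) := Set.disjoint_sdiff_right
  have hE := fun {x w : Box} => lt_of_west_neighbor (x := x) (w := w) hWl hG hlW hlG hdisj hs hsW
  set w := ((b.1, b.2 + 1) : Box) - v with hwdef
  set q := ((o.1 - 1, o.2 - 1) : Box) - v with hqdef
  have hw1 : w.1 = b.1 - v.1 := rfl
  have hw2 : w.2 = b.2 + 1 - v.2 := rfl
  have hq1 : q.1 = o.1 - 1 - v.1 := rfl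
  have hq2 : q.2 = o.2 - 1 - v.2 := rfl
  clear_value w q
  simp only [diagB] at *
  have hx : ((q.1, q.2 + 1) : Box) ∈ γ :=
    mem_of_between hγ hq (hlγ hw) _ (by simp) (by simp) (by simp only; omega) (by simp only; omega)
  by_cases hxW : ((q.1, q.2 + 1) : Box) ∈ Wl
  · have h : ((q.1 + 1, q.2 + 1) : Box) ∈ Wl := mem_of_between hWl hxW hw _
      (by simp) (by simp) (by simp only; omega) (by simp only; omega)
    have := hE hqG h (by omega) (by simp only; omega)
    simp only at this
    omega
  · have := hE ⟨hx, hxW⟩ hw (by simp only; omega) (by simp only; omega)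
    simp only at this
    omega

/-- The part of the upper-left boundary of `A` on a range of diagonals where `A` agrees with an
order-connected set `C` meeting each of them has one box per diagonal. -/
theorem card_ulBoundary_filter {A : Finset Box} {C : Set Box} (hC : C.OrdConnected) {l h : ℤ}
    (hAC : ∀ x, l ≤ diagB x → diagB x < h → (x ∈ A ↔ x ∈ C))
    (hne : ∀ t, l ≤ t → t < h → ∃ x ∈ C, diagB x = t) :
    ((ulBoundary A).filter (fun x => l ≤ diagB x ∧ diagB x < h)).card = (h - l).toNat := by
  rw [← Int.card_Ico]
  refine Finset.card_nbij diagB ?_ ?_ ?_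
  · intro x hx
    simpa using (Finset.mem_filter.1 hx).2
  · have key : ∀ x ∈ (ulBoundary A).filter (fun x => l ≤ diagB x ∧ diagB x < h),
        ∀ y ∈ (ulBoundary A).filter (fun x => l ≤ diagB x ∧ diagB x < h),
        diagB x = diagB y → y.1 ≤ x.1 := by
      intro x hx y hy hxy
      simp only [ulBoundary, Finset.mem_filter] at hx hy
      by_contra! hlt
      have hx' := (hAC x hx.2.1 hx.2.2).1 hx.1.1
      have hy' := (hAC y hy.2.1 hy.2.2).1 hy.1.1
      have hd : diagB ((y.1 - 1, y.2 - 1) : Box) = diagB y := by simp only [diagB]; omega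
      refine hy.1.2 ((hAC _ (hd ▸ hy.2.1) (hd ▸ hy.2.2)).2 ?_)
      simp only [diagB] at hxy
      exact mem_of_between hC hx' hy' _ (by simp only; omega) (by simp only; omega) (by simp)
        (by simp)
    intro x hx y hy hxy
    have h₁ := key x hx y hy hxy
    have h₂ := key y hy x hx hxy.symm
    simp only [diagB] at hxy
    exact Prod.ext (by omega) (by omega)
  · intro t ht
    simp only [Finset.coe_Ico, Set.mem_Ico] at ht
    obtain ⟨x, hx, hxt⟩ := hne t ht.1 ht.2
    obtain ⟨o, ho, homin⟩ := Finset.exists_min_image (A.filter (fun x => diagB x = t)) Prod.fst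
      ⟨x, Finset.mem_filter.2 ⟨(hAC x (by omega) (by omega)).2 hx, hxt⟩⟩
    rw [Finset.mem_filter] at ho
    refine ⟨o, ?_, ho.2⟩
    simp only [ulBoundary, Finset.coe_filter, Set.mem_ofPred_eq, Finset.mem_filter]
    refine ⟨⟨ho.1, fun h => ?_⟩, by omega, by omega⟩
    have := homin _ (Finset.mem_filter.2 ⟨h, by rw [← ho.2]; simp only [diagB]; omega⟩)
    simp only at this
    omega

/-- A connected ribbon has exactly one box on each diagonal of its diagonal range. -/
theorem IsRibbon.exists_ends {δ : Finset Box} (hrib : IsRibbon δ) (hconn : IsConnectedShape δ) :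
    ∃ x ∈ δ, ∃ y ∈ δ, diagB y = diagB x + δ.card - 1 ∧
      (∀ z ∈ δ, diagB x ≤ diagB z ∧ diagB z ≤ diagB y) ∧ Set.InjOn diagB (δ : Set Box) := by
  have hoc := hrib.1.ordConnected
  have key : ∀ x ∈ δ, ∀ y ∈ δ, diagB x = diagB y → y.1 ≤ x.1 := by
    intro x hx y hy hxy
    by_contra! hlt
    simp only [diagB] at hxy
    refine hrib.2 x.1 x.2 ⟨hx, ?_, ?_, ?_⟩ <;>
      exact mem_of_between hoc hx hy _ (by simp) (by simp) (by simp only; omega)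
        (by simp only; omega)
  have hinj : Set.InjOn diagB (δ : Set Box) := by
    intro x hx y hy hxy
    have h₁ := key x hx y hy hxy
    have h₂ := key y hy x hx hxy.symm
    simp only [diagB] at hxy
    exact Prod.ext (by omega) (by omega)
  obtain ⟨x, hx, hxmin⟩ := Finset.exists_min_image δ diagB hconn.1
  obtain ⟨y, hy, hymax⟩ := Finset.exists_max_image δ diagB hconn.1
  refine ⟨x, hx, y, hy, ?_, fun z hz => ⟨hxmin z hz, hymax z hz⟩, hinj⟩
  have himg : δ.image diagB = Finset.Icc (diagB x) (diagB y) := by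
    ext t
    simp only [Finset.mem_image, Finset.mem_Icc]
    constructor
    · rintro ⟨z, hz, rfl⟩
      exact ⟨hxmin z hz, hymax z hz⟩
    · rintro ⟨h₁, h₂⟩
      exact hconn.diagLinked.exists_mem hx hy h₁ h₂
  have hc := Finset.card_image_of_injOn hinj
  rw [himg, Int.card_Icc] at hc
  have := hxmin y hy
  omega

/-- In a periodic strip, the ends of a ribbon as long as the period cannot both be free. -/
theorem false_of_left_ends {Λ : Set Box} (hΛ : Λ.OrdConnected) {p : Box}
    (hper : ∀ x, x + p ∈ Λ ↔ x ∈ Λ) (hlink : ∀ t, LinkedAt Λ t) {x y : Box} (hx : x ∈ Λ)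
    (hy : y ∈ Λ) (hxy : diagB y = diagB x + diagB p - 1)
    (hx₁ : ((x.1, x.2 - 1) : Box) ∉ Λ) (hx₂ : ((x.1 - 1, x.2 - 1) : Box) ∉ Λ)
    (hy₁ : ((y.1 - 1, y.2) : Box) ∉ Λ) (hy₂ : ((y.1 - 1, y.2 - 1) : Box) ∉ Λ) : False := by
  rw [← hper] at hx hx₁ hx₂
  have hxr : ((x.1, x.2 - 1) : Box) + p = (x.1 + p.1, x.2 + p.2 - 1) :=
    Prod.ext rfl (by simp only [Prod.snd_add]; omega)
  have hxd : ((x.1 - 1, x.2 - 1) : Box) + p = (x.1 + p.1 - 1, x.2 + p.2 - 1) :=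
    Prod.ext (by simp only [Prod.fst_add]; omega) (by simp only [Prod.snd_add]; omega)
  rw [hxr] at hx₁
  rw [hxd] at hx₂
  have hzdef : x + p = (x.1 + p.1, x.2 + p.2) := rfl
  rw [hzdef] at hx
  obtain ⟨u, hu, u', hu', hd, hd', hle⟩ := hlink (diagB y)
  simp only [diagB] at *
  have hyu : y.1 ≤ u.1 := by
    by_contra! h
    exact hy₂ (mem_of_between hΛ hu hy _ (by simp only; omega) (by simp only; omega) (by simp)
      (by simp))
  have hyu' : y.1 ≤ u'.1 := by
    by_contra! h
    exact hy₁ (mem_of_between hΛ hu' hy _ (by simp only; omega) (by simp only; omega) (by simp)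
      (by simp))
  have hye : ((y.1, y.2 + 1) : Box) ∈ Λ := mem_of_between hΛ hy hu' _ le_rfl (by simp)
    (by simp only; omega) (by simp only; omega)
  rcases lt_trichotomy (x.1 + p.1) y.1 with h | h | h
  · exact hy₁ (mem_of_between hΛ hx hy _ (by simp only; omega) (by simp only; omega) (by simp)
      (by simp))
  · exact hx₁ (mem_of_between hΛ hy hy _ (by simp only; omega) (by simp only; omega)
      (by simp only; omega) (by simp only; omega))
  · exact hx₂ (mem_of_between hΛ hye hx _ (by simp only; omega) (by simp only; omega) (by simp)
      (by simp))

theorem false_of_right_ends {Λ : Set Box} (hΛ : Λ.OrdConnected) {p : Box}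
    (hper : ∀ x, x + p ∈ Λ ↔ x ∈ Λ) (hlink : ∀ t, LinkedAt Λ t) {x y : Box} (hx : x ∈ Λ)
    (hy : y ∈ Λ) (hxy : diagB y = diagB x + diagB p - 1)
    (hx₁ : ((x.1 + 1, x.2) : Box) ∉ Λ) (hx₂ : ((x.1 + 1, x.2 + 1) : Box) ∉ Λ)
    (hy₁ : ((y.1, y.2 + 1) : Box) ∉ Λ) (hy₂ : ((y.1 + 1, y.2 + 1) : Box) ∉ Λ) : False := by
  have hneg : ∀ a b : ℤ, (-(a, b) : Box) = (-a, -b) := fun _ _ => rfl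
  refine false_of_left_ends (Λ := Neg.neg ⁻¹' Λ) (p := p) (x := -y) (y := -x) ?_ ?_ ?_ ?_ ?_ ?_
    ?_ ?_ ?_ ?_
  · exact ⟨fun _ ha _ hc _ hb => hΛ.out hc ha ⟨neg_le_neg hb.2, neg_le_neg hb.1⟩⟩
  · intro z
    rw [Set.mem_preimage, Set.mem_preimage, ← hper (-(z + p))]
    simp
  · intro t
    obtain ⟨u, hu, u', hu', h⟩ := hlink (-t - 1)
    refine ⟨-u', by simpa using hu', -u, by simpa using hu, ?_⟩
    simp only [diagB, Prod.fst_neg, Prod.snd_neg] at *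
    omega
  · simpa using hy
  · simpa using hx
  · simp only [diagB, Prod.fst_neg, Prod.snd_neg] at *
    omega
  all_goals
    simp only [Set.mem_preimage, hneg, neg_sub, neg_neg, sub_neg_eq_add]
    first
    | simpa only [add_comm] using hy₁
    | simpa only [add_comm] using hy₂
    | simpa only [add_comm] using hx₁
    | simpa only [add_comm] using hx₂

theorem exists_mem_truncBox (b : Box) : ∃ N₀ : ℕ, ∀ N, N₀ ≤ N → b ∈ truncBox N := by
  refine ⟨b.1.natAbs + b.2.natAbs, fun N hN => ?_⟩
  simp only [truncBox, Set.mem_ofPred_eq]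
  omega

theorem exists_truncation (Λ : Set Box) (N : ℕ) :
    ∃ F : Finset Box, (F : Set Box) = Λ ∩ truncBox N := by
  have hfin : (truncBox N).Finite := (Set.finite_Icc ((-(N : ℤ), -(N : ℤ)) : Box) (N, N)).subset
    fun b hb => ⟨⟨hb.1, hb.2.2.1⟩, ⟨hb.2.1, hb.2.2.2⟩⟩
  exact ⟨(hfin.subset Set.inter_subset_right).toFinset, Set.Finite.coe_toFinset _⟩

/-- A common large truncation of `Λ` containing two given boxes of `Λ`. -/
theorem exists_large_truncation {Λ : Set Box} {P : Finset Box → Prop}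
    (h : ∃ N₀ : ℕ, ∀ N : ℕ, N₀ ≤ N → ∀ F : Finset Box, (F : Set Box) = Λ ∩ truncBox N → P F)
    (a b c : Box) : ∃ F : Finset Box, P F ∧ (F : Set Box) ⊆ Λ ∧ (a ∈ Λ → a ∈ F) ∧
      (b ∈ Λ → b ∈ F) ∧ (c ∈ Λ → c ∈ F) := by
  obtain ⟨N₀, h⟩ := h
  obtain ⟨Na, ha⟩ := exists_mem_truncBox a
  obtain ⟨Nb, hb⟩ := exists_mem_truncBox b
  obtain ⟨Nc, hc⟩ := exists_mem_truncBox c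
  obtain ⟨F, hF⟩ := exists_truncation Λ (N₀ + Na + Nb + Nc)
  refine ⟨F, h _ (by omega) F hF, hF ▸ Set.inter_subset_left, ?_, ?_, ?_⟩ <;> intro hmem <;>
    rw [← Finset.mem_coe, hF]
  exacts [⟨hmem, ha _ (by omega)⟩, ⟨hmem, hb _ (by omega)⟩, ⟨hmem, hc _ (by omega)⟩]

theorem TakenOutLeftInfAt.ordConnected {T : Finset Box} {Λ : Set Box}
    (h : TakenOutLeftInfAt T Λ) : Λ.OrdConnected := by
  refine ⟨fun x hx z hz y hy => ?_⟩
  obtain ⟨F, hF, hsub, hxF, hzF, -⟩ := exists_large_truncation h x z y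
  exact hsub (hF.ordConnected.out (hxF hx) (hzF hz) hy)

theorem TakenOutLeftInfAt.mem {T : Finset Box} {Λ : Set Box}
    (h : TakenOutLeftInfAt T Λ) {x : Box} (hx : x ∈ T) : x ∈ Λ := by
  obtain ⟨F, hF, hsub, -⟩ := exists_large_truncation h x x x
  exact hsub (hF.subset hx)

theorem TakenOutLeftInfAt.mem_of_le {T : Finset Box} {Λ : Set Box}
    (h : TakenOutLeftInfAt T Λ) {x y : Box} (hx : x ∈ Λ) (hy : y ∈ T) (hxy : x ≤ y) : x ∈ T := by
  obtain ⟨F, hF, -, hxF, -⟩ := exists_large_truncation h x x x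
  exact hF.mem_of_le (hxF hx) hy hxy

theorem TakenOutRightInfAt.ordConnected {T : Finset Box} {Λ : Set Box}
    (h : TakenOutRightInfAt T Λ) : Λ.OrdConnected := by
  refine ⟨fun x hx z hz y hy => ?_⟩
  obtain ⟨F, hF, hsub, hxF, hzF, -⟩ := exists_large_truncation h x z y
  exact hsub (hF.ordConnected.out (hxF hx) (hzF hz) hy)

theorem TakenOutRightInfAt.mem {T : Finset Box} {Λ : Set Box}
    (h : TakenOutRightInfAt T Λ) {x : Box} (hx : x ∈ T) : x ∈ Λ := by
  obtain ⟨F, hF, hsub, -⟩ := exists_large_truncation h x x x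
  exact hsub (hF.subset hx)

theorem TakenOutRightInfAt.mem_of_le {T : Finset Box} {Λ : Set Box}
    (h : TakenOutRightInfAt T Λ) {x y : Box} (hx : x ∈ Λ) (hy : y ∈ T) (hxy : y ≤ x) : x ∈ T := by
  obtain ⟨F, hF, -, hxF, -⟩ := exists_large_truncation h x x x
  exact hF.mem_of_le (hxF hx) hy hxy

theorem exists_translate_ends {δ T : Finset Box} (hrib : IsRibbon δ) (hconn : IsConnectedShape δ)
    (hT : ∃ u, T = translateS u δ) :
    ∃ x ∈ T, ∃ y ∈ T, diagB y = diagB x + δ.card - 1 ∧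
      (∀ z ∈ T, diagB x ≤ diagB z ∧ diagB z ≤ diagB y) ∧ Set.InjOn diagB (T : Set Box) := by
  obtain ⟨u, rfl⟩ := hT
  obtain ⟨x, hx, y, hy, hxy, hz, hinj⟩ := hrib.exists_ends hconn
  have hadd : ∀ z : Box, diagB z = diagB (z - u) + diagB u := fun z => by
    simp only [diagB, Prod.fst_sub, Prod.snd_sub]
    omega
  refine ⟨u + x, add_mem_translateS.2 hx, u + y, add_mem_translateS.2 hy, ?_, ?_, ?_⟩
  · simp only [diagB, Prod.fst_add, Prod.snd_add] at *
    omega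
  · intro z hz'
    have := hz _ (mem_translateS.1 hz')
    simp only [diagB, Prod.fst_add, Prod.snd_add, Prod.fst_sub, Prod.snd_sub] at *
    omega
  · intro a ha b hb hab
    rw [hadd a, hadd b] at hab
    exact sub_left_injective
      (hinj (mem_translateS.1 ha) (mem_translateS.1 hb) (add_right_cancel hab))

theorem not_takenOutLeftInf {δ : Finset Box} (hrib : IsRibbon δ) (hconn : IsConnectedShape δ)
    {Λ : Set Box} {p : Box} (hper : ∀ x, x + p ∈ Λ ↔ x ∈ Λ) (hlink : ∀ t, LinkedAt Λ t)
    (hcard : (δ.card : ℤ) = diagB p) : ¬ TakenOutLeftInf δ Λ := by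
  rintro ⟨T, hT, h⟩
  obtain ⟨x, hx, y, hy, hxy, hz, hinj⟩ := exists_translate_ends hrib hconn hT
  rw [hcard] at hxy
  refine false_of_left_ends h.ordConnected hper hlink (h.mem hx) (h.mem hy) hxy
    (fun hm => ?_) (fun hm => ?_) (fun hm => ?_) (fun hm => ?_)
  · have := hz _ (h.mem_of_le hm hx ⟨by simp, by simp⟩)
    simp only [diagB] at this
    omega
  · have := hinj (h.mem_of_le hm hx ⟨by simp, by simp⟩) hx (by simp only [diagB]; omega)
    have := congrArg Prod.fst this
    simp only at this
    omega
  · have := hz _ (h.mem_of_le hm hy ⟨by simp, by simp⟩)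
    simp only [diagB] at this
    omega
  · have := hinj (h.mem_of_le hm hy ⟨by simp, by simp⟩) hy (by simp only [diagB]; omega)
    have := congrArg Prod.fst this
    simp only at this
    omega

theorem not_takenOutRightInf {δ : Finset Box} (hrib : IsRibbon δ) (hconn : IsConnectedShape δ)
    {Λ : Set Box} {p : Box} (hper : ∀ x, x + p ∈ Λ ↔ x ∈ Λ) (hlink : ∀ t, LinkedAt Λ t)
    (hcard : (δ.card : ℤ) = diagB p) : ¬ TakenOutRightInf δ Λ := by
  rintro ⟨T, hT, h⟩
  obtain ⟨x, hx, y, hy, hxy, hz, hinj⟩ := exists_translate_ends hrib hconn hT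
  rw [hcard] at hxy
  refine false_of_right_ends h.ordConnected hper hlink (h.mem hx) (h.mem hy) hxy
    (fun hm => ?_) (fun hm => ?_) (fun hm => ?_) (fun hm => ?_)
  · have := hz _ (h.mem_of_le hm hx ⟨by simp, by simp⟩)
    simp only [diagB] at this
    omega
  · have := hinj (h.mem_of_le hm hx ⟨by simp, by simp⟩) hx (by simp only [diagB]; omega)
    have := congrArg Prod.fst this
    simp only at this
    omega
  · have := hz _ (h.mem_of_le hm hy ⟨by simp, by simp⟩)
    simp only [diagB] at this
    omega
  · have := hinj (h.mem_of_le hm hy ⟨by simp, by simp⟩) hy (by simp only [diagB]; omega)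
    have := congrArg Prod.fst this
    simp only at this
    omega

theorem diag_le_of_isSWBox {O : Finset Box} {G : Set Box} (hG : G.OrdConnected) {s : Box}
    (hs : IsSWBox O s) (hOG : ∀ x ∈ O, x ∈ G) (hGO : ∀ x ∈ G, diagB x < diagB s → x ∈ O) :
    ∀ x ∈ G, diagB s ≤ diagB x := by
  intro x hx
  by_contra! h
  have hrow := hs.2.1 x (hGO x hx h)
  simp only [diagB] at h
  have hw : ((s.1, s.2 - 1) : Box) ∈ G := mem_of_between hG hx (hOG s hs.1) _ (by simpa)
    (by simp only; omega) le_rfl (by simp)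
  have := hs.2.2 _ (hGO _ hw (by simp only [diagB]; omega)) rfl
  simp only at this
  omega

theorem diag_le_of_isNEBox {O : Finset Box} {G : Set Box} (hG : G.OrdConnected) {b : Box}
    (hb : IsNEBox O b) (hOG : ∀ x ∈ O, x ∈ G) (hGO : ∀ x ∈ G, diagB b < diagB x → x ∈ O) :
    ∀ x ∈ G, diagB x ≤ diagB b := by
  intro x hx
  by_contra! h
  have hrow := hb.2.1 x (hGO x hx h)
  simp only [diagB] at h
  have he : ((b.1, b.2 + 1) : Box) ∈ G := mem_of_between hG (hOG b hb.1) hx _ le_rfl (by simp)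
    (by simpa) (by simp only; omega)
  have := hb.2.2 _ (hGO _ he (by simp only [diagB]; omega)) rfl
  simp only at this
  omega

/-- The key ribbon has one box for each diagonal from the lower to the upper copy of `W`. -/
theorem IsWOW.card_topKeyRibbon {right : Bool} {γ W O Wlow Wup : Finset Box} {v : Box}
    (hWOW : IsWOW right γ W O Wlow Wup v) :
    ((topKeyRibbon right γ O v).card : ℤ) = diagB v := by
  obtain ⟨hγ, hW, ⟨⟨tl, hWl⟩, hlγ, hlc, -⟩, ⟨⟨tu, hWu⟩, huγ, huc, -⟩, hv, hsu, hcu, hsl, hcl, hO,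
    ⟨k, hkl, hku⟩, hatt, -⟩ := hWOW
  have htr : ∀ x, x ∈ Wup ↔ x - v ∈ Wlow := fun x => by rw [← hv, mem_translateS]
  have hadd : ∀ x : Box, diagB (x - v) = diagB x - diagB v := fun x => by
    simp only [diagB, Prod.fst_sub, Prod.snd_sub]
    omega
  have hoγ := hγ.ordConnected
  have hol : (Wlow : Set Box).OrdConnected := hWl ▸ ordConnected_translateS hW.ordConnected
  have hou : (Wup : Set Box).OrdConnected := hWu ▸ ordConnected_translateS hW.ordConnected
  have hogl := hsl.ordConnected
  have hogu := hsu.ordConnected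
  have hlgl := hcl.diagLinked
  have hlgu := hcu.diagLinked
  have hmemO : ∀ x, x ∈ O ↔ x ∈ γ ∧ x ∉ Wlow ∧ x ∉ Wup := fun x => by simp [hO]
  have hvpos : 0 < diagB v := by
    obtain ⟨w, hw⟩ := huc.1
    have h₁ := hku w hw
    have h₂ := hkl _ ((htr w).1 hw)
    rw [hadd] at h₂
    omega
  obtain ⟨s, b, hs, hb, hsk, hbk⟩ : ∃ s b, IsSWBox O s ∧ IsNEBox O b ∧
      (if right then ((s.1, s.2 - 1) : Box) ∈ Wlow else ((s.1 + 1, s.2) : Box) ∈ Wlow) ∧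
      (if right then ((b.1, b.2 + 1) : Box) ∈ Wup else ((b.1 - 1, b.2) : Box) ∈ Wup) := by
    cases right
    all_goals
      obtain ⟨⟨s, hs, hs'⟩, ⟨b, hb, hb'⟩⟩ := hatt
      exact ⟨s, b, hs, hb, hs', hb'⟩
  have hsk' : diagB s ≤ k := by
    cases right
    all_goals
      have := hkl _ hsk
      simp only [diagB] at *
      omega
  have hbk' : k ≤ diagB b := by
    cases right
    all_goals
      have := hku _ hbk
      simp only [diagB] at *
      omega
  have hsO := (hmemO s).1 hs.1
  have hbO := (hmemO b).1 hb.1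
  have hmin : ∀ x ∈ γ \ Wlow, diagB s ≤ diagB x := by
    refine diag_le_of_isSWBox hogl hs (fun x hx => ?_) (fun x hx hlt => ?_)
    · have := (hmemO x).1 hx
      simp [this]
    · rw [Finset.mem_coe, Finset.mem_sdiff] at hx
      exact (hmemO x).2 ⟨hx.1, hx.2, fun h => by have := hku x h; omega⟩
  have hmax : ∀ x ∈ γ \ Wup, diagB x ≤ diagB b := by
    refine diag_le_of_isNEBox hogu hb (fun x hx => ?_) (fun x hx hlt => ?_)
    · have := (hmemO x).1 hx
      simp [this]
    · rw [Finset.mem_coe, Finset.mem_sdiff] at hx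
      exact (hmemO x).2 ⟨hx.1, fun h => by have := hkl x h; omega, hx.2⟩
  have hminO : ∀ x ∈ O, diagB s ≤ diagB x := fun x hx => hmin x (by
    have := (hmemO x).1 hx
    simp [this])
  have hmaxO : ∀ x ∈ O, diagB x ≤ diagB b := fun x hx => hmax x (by
    have := (hmemO x).1 hx
    simp [this])
  have hup : ∀ x ∈ γ, diagB b < diagB x → x ∈ translateS v γ := fun x hx hlt => by
    by_cases h : x ∈ Wup
    · exact mem_translateS.2 (hlγ ((htr x).1 h))
    · exact absurd (hmax x (Finset.mem_sdiff.2 ⟨hx, h⟩)) hlt.not_ge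
  have hlow : ∀ x ∈ translateS v γ, diagB x < diagB s + diagB v → x ∈ γ := fun x hx hlt => by
    rw [mem_translateS] at hx
    by_cases h : x - v ∈ Wlow
    · exact huγ ((htr x).2 h)
    · have := hmin _ (Finset.mem_sdiff.2 ⟨hx, h⟩)
      rw [hadd] at this
      omega
  have hshift : ∀ o : Box, (((v + o).1 - 1, (v + o).2 - 1) : Box) - v = (o.1 - 1, o.2 - 1) :=
    fun o => Prod.ext (by simp only [Prod.fst_sub, Prod.fst_add]; omega)
      (by simp only [Prod.snd_sub, Prod.snd_add]; omega)
  have hdnw : ∀ o : Box, diagB ((o.1 - 1, o.2 - 1) : Box) = diagB o := fun o => by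
    simp only [diagB]
    omega
  have hdv : ∀ o : Box, diagB (v + o) = diagB o + diagB v := fun o => by
    simp only [diagB, Prod.fst_add, Prod.snd_add]
    omega
  cases right
  case true =>
    simp only [if_true] at hsk hbk
    obtain ⟨o, ho, hob, ho₁, ho₂⟩ := exists_boundary_box (v := v) γ.finite_toSet hoγ hol hou
      (by rwa [← Finset.coe_sdiff]) hlc.diagLinked (by rwa [← Finset.coe_sdiff]) hlγ huγ htr
      (s := s) ⟨hsO.1, hsO.2.1⟩ hsk hbO.1 hbO.2.2 hbk
      (fun x hx => (hkl x hx).trans_le hbk')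
      (fun x hx => hmin x (Finset.mem_sdiff.2 hx))
    have hoO : o ∈ O := (hmemO o).2 ⟨ho.1, fun h => ho.2 (Or.inl h), fun h => ho.2 (Or.inr h)⟩
    have hoU : o ∈ ulBoundary (γ ∪ translateS v γ) := by
      simp only [ulBoundary, Finset.mem_filter, Finset.mem_union, mem_translateS]
      exact ⟨Or.inl ho.1, fun h => h.elim ho₁ ho₂⟩
    have hvoU : v + o ∈ ulBoundary (γ ∪ translateS v γ) := by
      simp only [ulBoundary, Finset.mem_filter, Finset.mem_union]
      refine ⟨Or.inr (add_mem_translateS.2 ho.1), fun h => ho₁ ?_⟩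
      have h' := h.elim (fun h => hup _ h (by rw [hdnw, hdv]; omega)) id
      rw [mem_translateS, hshift] at h'
      exact h'
    have hkey : topKeyRibbon true γ O v = (ulBoundary (γ ∪ translateS v γ)).filter
        (fun x => diagB b + 1 ≤ diagB x ∧ diagB x < diagB b + diagB v + 1) := by
      simp only [topKeyRibbon, if_true]
      refine Finset.filter_congr fun x _ => and_congr ⟨fun h => ?_, fun h y hy => ?_⟩
        ⟨fun ⟨y, hy, hxy⟩ => ?_, fun h => ⟨v + o, ?_, ?_⟩⟩
      · have := h o (Finset.mem_inter.2 ⟨hoU, hoO⟩)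
        omega
      · have := hmaxO y (Finset.mem_inter.1 hy).2
        omega
      · have := hmaxO _ (mem_translateS.1 (Finset.mem_inter.1 hy).2)
        rw [hadd] at this
        omega
      · exact Finset.mem_inter.2 ⟨hvoU, add_mem_translateS.2 hoO⟩
      · rw [hdv]
        omega
    rw [hkey, card_ulBoundary_filter (C := translateS v γ) (ordConnected_translateS hoγ)]
    · omega
    · intro x hx _
      rw [Finset.mem_union, Finset.mem_coe]
      exact ⟨fun h => h.elim (fun h => hup x h (by omega)) id, Or.inr⟩
    · intro t ht₁ ht₂
      have hw := (htr _).1 hbk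
      have hwu : ((b.1, b.2 + 1) : Box) - v ∈ γ \ Wup := Finset.mem_sdiff.2
        ⟨hlγ hw, fun h => by have := hku _ h; have := hkl _ hw; omega⟩
      obtain ⟨z, hz, hzt⟩ := hlgu.exists_mem hwu (y := b) (by simp [hbO]) (t := t - diagB v)
        (by rw [hadd]; simp only [diagB] at *; omega) (by omega)
      refine ⟨v + z, ?_, by rw [hdv]; omega⟩
      exact add_mem_translateS.2 (Finset.mem_sdiff.1 hz).1
  case false =>
    simp only [Bool.false_eq_true, if_false] at hsk hbk
    have hds : ∀ x : Box, diagB x.swap = -diagB x := fun x => by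
      simp only [diagB, Prod.fst_swap, Prod.snd_swap]
      omega
    obtain ⟨o', ho, hob, ho₁, ho₂⟩ := exists_boundary_box (γ := Prod.swap ⁻¹' (γ : Set Box))
      (Wl := Prod.swap ⁻¹' (Wup : Set Box)) (Wu := Prod.swap ⁻¹' (Wlow : Set Box))
      (v := (-v).swap) (s := b.swap) (b := s.swap)
      (γ.finite_toSet.preimage Prod.swap_injective.injOn) (ordConnected_swap hoγ)
      (ordConnected_swap hou) (ordConnected_swap hol)
      (by rw [← Set.preimage_sdiff, ← Finset.coe_sdiff]; exact ordConnected_swap hogu)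
      huc.diagLinked.swap (by rw [← Set.preimage_sdiff, ← Finset.coe_sdiff]; exact hlgu.swap)
      (Set.preimage_mono huγ) (Set.preimage_mono hlγ)
      (fun x => by
        have := htr (x.swap + v)
        rw [add_sub_cancel_right] at this
        simp only [Set.mem_preimage, Finset.mem_coe, ← this]
        congr! 1
        refine Prod.ext ?_ ?_ <;> simp)
      ⟨hbO.1, hbO.2.2⟩ hbk hsO.1 hsO.2.1 hsk
      (fun x hx => by have := hku _ hx; rw [hds] at *; omega)
      (fun x hx => by have := hmax _ (Finset.mem_sdiff.2 hx); rw [hds] at *; omega)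
    obtain ⟨o, rfl⟩ := Prod.swap_surjective o'
    have hos : diagB o = diagB s := by rw [hds, hds] at hob; omega
    have ho₁ : ((o.1 - 1, o.2 - 1) : Box) ∉ γ := ho₁
    have ho₂ : (((v + o).1 - 1, (v + o).2 - 1) : Box) ∉ γ := fun h => ho₂ (by
      rw [Set.mem_preimage, Finset.mem_coe]
      convert h using 1
      refine Prod.ext ?_ ?_ <;> simp <;> ring)
    have hoγ' : o ∈ γ := ho.1
    have hoO : o ∈ O := (hmemO o).2 ⟨ho.1, fun h => ho.2 (Or.inr h), fun h => ho.2 (Or.inl h)⟩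
    have hoU : o ∈ ulBoundary (γ ∪ translateS v γ) := by
      simp only [ulBoundary, Finset.mem_filter, Finset.mem_union]
      exact ⟨Or.inl hoγ', fun h => ho₁ (h.elim id (fun h => hlow _ h (by rw [hdnw]; omega)))⟩
    have hvoU : v + o ∈ ulBoundary (γ ∪ translateS v γ) := by
      simp only [ulBoundary, Finset.mem_filter, Finset.mem_union]
      refine ⟨Or.inr (add_mem_translateS.2 hoγ'), fun h => h.elim ho₂ (fun h => ho₁ ?_)⟩
      rwa [mem_translateS, hshift] at h
    have hkey : topKeyRibbon false γ O v = (ulBoundary (γ ∪ translateS v γ)).filter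
        (fun x => diagB s ≤ diagB x ∧ diagB x < diagB s + diagB v) := by
      simp only [topKeyRibbon, Bool.false_eq_true, if_false]
      refine Finset.filter_congr fun x _ => and_congr ⟨fun ⟨y, hy, hxy⟩ => ?_, fun h => ⟨o, ?_, ?_⟩⟩
        ⟨fun h => ?_, fun h y hy => ?_⟩
      · exact (hminO y (Finset.mem_inter.1 hy).2).trans hxy
      · exact Finset.mem_inter.2 ⟨hoU, hoO⟩
      · omega
      · have := h (v + o) (Finset.mem_inter.2 ⟨hvoU, add_mem_translateS.2 hoO⟩)
        rw [hdv] at this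
        omega
      · have := hminO _ (mem_translateS.1 (Finset.mem_inter.1 hy).2)
        rw [hadd] at this
        omega
    rw [hkey, card_ulBoundary_filter (C := γ) hoγ]
    · omega
    · intro x _ hx
      rw [Finset.mem_union, Finset.mem_coe]
      exact ⟨fun h => h.elim id (fun h => hlow x h hx), Or.inl⟩
    · intro t ht₁ ht₂
      have hw : v + ((s.1 + 1, s.2) : Box) ∈ Wup := (htr _).2 (by rwa [add_sub_cancel_left])
      have hwl : v + ((s.1 + 1, s.2) : Box) ∈ γ \ Wlow := Finset.mem_sdiff.2
        ⟨huγ hw, fun h => by have := hkl _ h; have := hku _ hw; omega⟩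
      obtain ⟨z, hz, hzt⟩ := hlgl.exists_mem (x := s) (by simp [hsO]) hwl (t := t)
        ht₁ (by rw [hdv]; simp only [diagB] at *; omega)
      exact ⟨z, (Finset.mem_sdiff.1 hz).1, hzt⟩

theorem IsWOW.exists_linkedAt {right : Bool} {γ W O Wlow Wup : Finset Box} {v : Box}
    (hWOW : IsWOW right γ W O Wlow Wup v) :
    0 < diagB v ∧ ∃ d, ∀ t, d ≤ t → t < d + diagB v → LinkedAt γ t := by
  obtain ⟨-, -, ⟨-, hlγ, hlc, -⟩, ⟨-, huγ, huc, -⟩, hv, -, hcu, -, hcl, hO, ⟨k, hkl, hku⟩, hatt,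
    -⟩ := hWOW
  obtain ⟨o, ho⟩ : ∃ o, o ∈ O := by
    cases right
    all_goals
      obtain ⟨⟨s, hs, -⟩, -⟩ := hatt
      exact ⟨s, hs.1⟩
  obtain ⟨w, hw⟩ := hlc.1
  have hwv : v + w ∈ Wup := hv ▸ add_mem_translateS.2 hw
  have h₁ := hkl w hw
  have h₂ := hku _ hwv
  have hdv : diagB (v + w) = diagB w + diagB v := by
    simp only [diagB, Prod.fst_add, Prod.snd_add]
    omega
  simp only [hO, Finset.mem_sdiff, Finset.mem_union, not_or] at ho
  refine ⟨by omega, diagB w, fun t ht₁ ht₂ => ?_⟩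
  rcases lt_or_ge t (diagB o) with h | h
  · exact (hcu.diagLinked w
      (Finset.mem_sdiff.2 ⟨hlγ hw, fun h => by have := hku _ h; omega⟩) o
      (Finset.mem_sdiff.2 ⟨ho.1, ho.2.2⟩) t ht₁ h).mono
      (Finset.coe_subset.2 Finset.sdiff_subset)
  · exact (hcl.diagLinked o (Finset.mem_sdiff.2 ⟨ho.1, ho.2.1⟩) (v + w)
      (Finset.mem_sdiff.2 ⟨huγ hwv, fun h => by have := hkl _ h; omega⟩) t h
      (by omega)).mono (Finset.coe_subset.2 Finset.sdiff_subset)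

theorem diagB_zsmul (m : ℤ) (p : Box) : diagB (m • p) = m * diagB p :=
  (mul_sub m p.2 p.1).symm

/-- The union of all translates of `γ` by multiples of `p`. -/
def periodicStrip (γ : Finset Box) (p : Box) : Set Box := {x | ∃ m : ℤ, x - m • p ∈ γ}

theorem add_mem_periodicStrip {γ : Finset Box} {p x : Box} :
    x + p ∈ periodicStrip γ p ↔ x ∈ periodicStrip γ p := by
  constructor
  · rintro ⟨m, hm⟩
    refine ⟨m - 1, ?_⟩
    convert hm using 1
    rw [sub_smul, one_smul]
    abel
  · rintro ⟨m, hm⟩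
    refine ⟨m + 1, ?_⟩
    convert hm using 1
    rw [add_smul, one_smul]
    abel

theorem linkedAt_periodicStrip {γ : Finset Box} {p : Box} {d : ℤ} (hp : 0 < diagB p)
    (h : ∀ t, d ≤ t → t < d + diagB p → LinkedAt γ t) (t : ℤ) :
    LinkedAt (periodicStrip γ p) t := by
  have hmod := Int.emod_add_mul_ediv (t - d) (diagB p)
  have hnonneg := Int.emod_nonneg (t - d) hp.ne'
  have hlt := Int.emod_lt_of_pos (t - d) hp
  set m := (t - d) / diagB p
  rw [mul_comm] at hmod
  obtain ⟨u, hu, u', hu', h₁, h₂, h₃, h₄⟩ := h (t - m * diagB p) (by omega) (by omega)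
  have hm := diagB_zsmul m p
  refine ⟨u + m • p, ⟨m, by simpa using hu⟩, u' + m • p, ⟨m, by simpa using hu'⟩, ?_⟩
  generalize m • p = q at *
  simp only [diagB, Prod.fst_add, Prod.snd_add] at *
  omega

theorem composeWOWSet_column (right : Bool) (γ : Finset Box) (v : Box) :
    composeWOWSet right γ v {p : Box | p.2 = 0} = periodicStrip γ (nVec right v) := by
  ext x
  simp only [composeWOWSet, periodicStrip, Set.mem_iUnion, Finset.mem_coe, mem_translateS,
    boxOffset, exists_prop]
  constructor
  · rintro ⟨b, hb, h⟩
    have hb : b.2 = 0 := hb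
    exact ⟨-b.1, by simpa [hb] using h⟩
  · rintro ⟨m, h⟩
    exact ⟨(-m, 0), rfl, by simpa using h⟩

theorem composeWOWSet_row (right : Bool) (γ : Finset Box) (v : Box) :
    composeWOWSet right γ v {p : Box | p.1 = 0} = periodicStrip γ (eVec right v) := by
  ext x
  simp only [composeWOWSet, periodicStrip, Set.mem_iUnion, Finset.mem_coe, mem_translateS,
    boxOffset, exists_prop]
  constructor
  · rintro ⟨b, hb, h⟩
    have hb : b.1 = 0 := hb
    exact ⟨b.2, by simpa [hb] using h⟩
  · rintro ⟨m, h⟩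
    exact ⟨(0, m), rfl, by simpa using h⟩

theorem diagB_nVec (right : Bool) (v : Box) : diagB (nVec right v) = diagB v := by
  cases right <;> simp [nVec, diagB]

theorem diagB_eVec (right : Bool) (v : Box) : diagB (eVec right v) = diagB v := by
  cases right <;> simp [eVec, diagB]

/-- Lemma "infinite strip".
Let `γ` be a `WOW` shape and `n` the common size of its key ribbons.  Let `c` be the
infinite one-column shape and `d` the infinite one-row shape.  Then no connected ribbon
of size `n` can be taken out on the left or on the right of either `c ∘_W γ` or
`d ∘_W γ`. -/
theorem statement7 (right : Bool) (γ W O Wlow Wup : Finset Box) (v : Box)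
    (hWOW : IsWOW right γ W O Wlow Wup v)
    (δ : Finset Box) (hrib : IsRibbon δ) (hconn : IsConnectedShape δ)
    (hcard : δ.card = (topKeyRibbon right γ O v).card) :
    ¬ TakenOutLeftInf δ (composeWOWSet right γ v {p : Box | p.2 = 0}) ∧
    ¬ TakenOutRightInf δ (composeWOWSet right γ v {p : Box | p.2 = 0}) ∧
    ¬ TakenOutLeftInf δ (composeWOWSet right γ v {p : Box | p.1 = 0}) ∧
    ¬ TakenOutRightInf δ (composeWOWSet right γ v {p : Box | p.1 = 0}) := by
  obtain ⟨hpos, d, hlink⟩ := hWOW.exists_linkedAt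
  have hδ : (δ.card : ℤ) = diagB v := by rw [hcard, hWOW.card_topKeyRibbon]
  have hstrip : ∀ p, diagB p = diagB v → ¬ TakenOutLeftInf δ (periodicStrip γ p) ∧
      ¬ TakenOutRightInf δ (periodicStrip γ p) := by
    intro p hp
    rw [← hp] at hδ hpos hlink
    have hl := linkedAt_periodicStrip hpos hlink
    exact ⟨not_takenOutLeftInf hrib hconn (fun _ => add_mem_periodicStrip) hl hδ,
      not_takenOutRightInf hrib hconn (fun _ => add_mem_periodicStrip) hl hδ⟩
  rw [composeWOWSet_column, composeWOWSet_row]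
  exact ⟨(hstrip _ (diagB_nVec right v)).1, (hstrip _ (diagB_nVec right v)).2,
    hstrip _ (diagB_eVec right v)⟩
end
end

section
/- Let β = (2,1), W = (1,1) (a column of two boxes), O = (2,2,1,1)/(1), and γ = (4,4,2,2)/(2,1); then γ is a W→O→W shape, and β ∘_W γ ∼ β* ∘_W γ, i.e. the skew Schur polynomials of the skew shape β ∘_W γ and of the skew shape β* ∘_W γ agree in every number of variables. -/
open scoped Classical

noncomputable section

/-- The partition shape `β = (2,1)`. -/
def beta21 : Finset Box :=
  {((0 : ℤ), (0 : ℤ)), ((0 : ℤ), (1 : ℤ)), ((1 : ℤ), (0 : ℤ))}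

/-- `W = (1,1)`, a column of two boxes. -/
def W10 : Finset Box := {((0 : ℤ), (0 : ℤ)), ((1 : ℤ), (0 : ℤ))}

/-- `γ = (4,4,2,2)/(2,1)`. -/
def gamma10 : Finset Box :=
  {((0 : ℤ), (2 : ℤ)), ((0 : ℤ), (3 : ℤ)),
   ((1 : ℤ), (1 : ℤ)), ((1 : ℤ), (2 : ℤ)), ((1 : ℤ), (3 : ℤ)),
   ((2 : ℤ), (0 : ℤ)), ((2 : ℤ), (1 : ℤ)),
   ((3 : ℤ), (0 : ℤ)), ((3 : ℤ), (1 : ℤ))}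

/-- The lower copy of `W` in `γ`. -/
def Wlow10 : Finset Box := {((2 : ℤ), (0 : ℤ)), ((3 : ℤ), (0 : ℤ))}

/-- The upper copy of `W` in `γ`. -/
def Wup10 : Finset Box := {((0 : ℤ), (3 : ℤ)), ((1 : ℤ), (3 : ℤ))}

/-- `O = γ` minus the two copies of `W`. -/
def O10 : Finset Box := gamma10 \ (Wlow10 ∪ Wup10)

/-- The abstract shape `O = (2,2,1,1)/(1)`. -/
def Oabs10 : Finset Box :=
  {((0 : ℤ), (1 : ℤ)), ((1 : ℤ), (0 : ℤ)), ((1 : ℤ), (1 : ℤ)),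
   ((2 : ℤ), (0 : ℤ)), ((3 : ℤ), (0 : ℤ))}

/-- The shift from the lower to the upper copy of `W`. -/
def v10 : Box := ((-2 : ℤ), (3 : ℤ))

/-- The complete homogeneous symmetric polynomial of degree `k` in `x 0, …, x (m - 1)`,
with `k` allowed to be negative. -/
def completeHom {R : Type*} [CommRing R] (x : ℕ → R) : ℕ → ℤ → R
  | 0, k => if k = 0 then 1 else 0
  | m + 1, k => ∑ p ∈ Finset.Icc 0 k, x m ^ (k - p).toNat * completeHom x m p

section CompleteHom

variable {R : Type*} [CommRing R] (x : ℕ → R)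

theorem completeHom_of_neg (m : ℕ) {k : ℤ} (hk : k < 0) : completeHom x m k = 0 := by
  cases m with
  | zero => simp [completeHom, hk.ne]
  | succ m => simp [completeHom, Finset.Icc_eq_empty (not_le.2 hk)]

theorem completeHom_zero_right (m : ℕ) : completeHom x m 0 = 1 := by
  induction m with
  | zero => simp [completeHom]
  | succ m ih => simp [completeHom, ih]

/-- Summation over a range of degrees may start at any nonpositive degree. -/
theorem completeHom_succ_eq_sum (m : ℕ) {a k : ℤ} (ha : a ≤ 0) :
    completeHom x (m + 1) k =
      ∑ p ∈ Finset.Icc a k, x m ^ (k - p).toNat * completeHom x m p := by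
  rw [completeHom]
  refine Finset.sum_subset (Finset.Icc_subset_Icc_left ha) fun p hp hp' => ?_
  rw [completeHom_of_neg x m, mul_zero]
  simp only [Finset.mem_Icc] at hp hp'
  omega

theorem completeHom_succ_eq_add (m : ℕ) {a k : ℤ} (hak : a ≤ k) :
    completeHom x (m + 1) k =
      (∑ p ∈ Finset.Icc (a + 1) k, x m ^ (k - p).toNat * completeHom x m p) +
        x m ^ (k - a).toNat * completeHom x (m + 1) a := by
  rw [completeHom_succ_eq_sum x m (min_le_right a 0),
    completeHom_succ_eq_sum x m (min_le_right a 0), Finset.mul_sum]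
  have hsplit : Finset.Icc (min a 0) k =
      Finset.Icc (a + 1) k ∪ Finset.Icc (min a 0) a := by
    ext p
    simp only [Finset.mem_Icc, Finset.mem_union]
    omega
  have hdisj : Disjoint (Finset.Icc (a + 1) k) (Finset.Icc (min a 0) a) := by
    rw [Finset.disjoint_left]
    intro p hp hp'
    simp only [Finset.mem_Icc] at hp hp'
    omega
  rw [hsplit, Finset.sum_union hdisj]
  congr 1
  refine Finset.sum_congr rfl fun p hp => ?_
  simp only [Finset.mem_Icc] at hp
  rw [← mul_assoc, ← pow_add]
  congr 2
  omega

end CompleteHom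

section JacobiTrudi

variable {R : Type*} [CommRing R] {n : ℕ}

/-- The skew diagram whose rows, indexed from bottom to top, are the intervals
`[l i, u i)`. -/
def rowDiagram (l u : Fin (n + 1) → ℤ) : Finset (Fin (n + 1) × ℤ) :=
  Finset.univ.biUnion fun i => (Finset.Ico (l i) (u i)).image (Prod.mk i)

theorem mem_rowDiagram {l u : Fin (n + 1) → ℤ} {b : Fin (n + 1) × ℤ} :
    b ∈ rowDiagram l u ↔ l b.1 ≤ b.2 ∧ b.2 < u b.1 := by
  obtain ⟨i, c⟩ := b
  simp [rowDiagram]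

/-- Semistandard fillings of a diagram with rows indexed from bottom to top. -/
def IsSemistandard {S : Finset (Fin (n + 1) × ℤ)} {m : ℕ} (g : S → Fin m) : Prop :=
  (∀ b c : S, b.1.1 = c.1.1 → b.1.2 ≤ c.1.2 → g b ≤ g c) ∧
  (∀ b c : S, b.1.2 = c.1.2 → c.1.1 < b.1.1 → g b < g c)

/-- The generating function of semistandard fillings of `S` with entries less than `m`. -/
def semistandardSum (x : ℕ → R) (S : Finset (Fin (n + 1) × ℤ)) (m : ℕ) : R :=
  ∑ g ∈ Finset.univ.filter (fun g : S → Fin m => IsSemistandard g), ∏ b, x (g b)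

/-- The possible right ends of row `i` after removing a horizontal strip. -/
def stripRange (l u : Fin (n + 1) → ℤ) (i : Fin (n + 1)) : Finset ℤ :=
  Finset.Icc (Fin.cases (l 0) (fun j : Fin n => u j.castSucc) i) (u i)

theorem le_of_mem_stripRange {l u v : Fin (n + 1) → ℤ}
    (hv : v ∈ Fintype.piFinset (stripRange l u)) : v ≤ u := fun i =>
  (Finset.mem_Icc.1 (Fintype.mem_piFinset.1 hv i)).2

theorem le_of_lt_of_mem_stripRange {l u v : Fin (n + 1) → ℤ} (hu : Monotone u)
    (hv : v ∈ Fintype.piFinset (stripRange l u)) {i j : Fin (n + 1)} (hij : i < j) :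
    u i ≤ v j := by
  have h := (Finset.mem_Icc.1 (Fintype.mem_piFinset.1 hv j)).1
  induction j using Fin.cases with
  | zero => exact absurd hij (Fin.not_lt_zero i)
  | succ j => exact (hu (Fin.le_castSucc_iff.2 hij)).trans h

theorem monotone_of_mem_stripRange {l u v : Fin (n + 1) → ℤ} (hu : Monotone u)
    (hv : v ∈ Fintype.piFinset (stripRange l u)) : Monotone v := by
  intro i j hij
  rcases hij.eq_or_lt with rfl | hij
  · exact le_rfl
  · exact (le_of_mem_stripRange hv i).trans (le_of_lt_of_mem_stripRange hu hv hij)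

/-- The Jacobi–Trudi matrix. -/
def jacobiTrudi (h : ℤ → R) (l u : Fin (n + 1) → ℤ) :
    Matrix (Fin (n + 1)) (Fin (n + 1)) R :=
  Matrix.of fun i j => h ((u i + i) - (l j + j))

theorem det_jacobiTrudi_succ (x : ℕ → R) (m : ℕ) {l u : Fin (n + 1) → ℤ}
    (hl : Monotone l) (hu : Monotone u) :
    (jacobiTrudi (completeHom x (m + 1)) l u).det =
      ∑ v ∈ Fintype.piFinset (stripRange l u),
        (∏ i, x m ^ (u i - v i).toNat) * (jacobiTrudi (completeHom x m) l v).det := by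
  let B : Matrix (Fin (n + 1)) (Fin (n + 1)) R := fun i =>
    ∑ c ∈ stripRange l u i, fun j =>
      x m ^ (u i - c).toNat * completeHom x m ((c + i) - (l j + j))
  have hshift (a b t k : ℤ) : ∑ c ∈ Finset.Icc a b,
      x m ^ (b - c).toNat * completeHom x m (c + t - k) =
      ∑ p ∈ Finset.Icc (a + t - k) (b + t - k),
        x m ^ (b + t - k - p).toNat * completeHom x m p := by
    refine Finset.sum_bij' (fun c _ => c + t - k) (fun p _ => p - t + k) ?_ ?_ ?_ ?_ ?_
    · intro c hc; simp only [Finset.mem_Icc] at hc ⊢; omega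
    · intro c hc; simp only [Finset.mem_Icc] at hc ⊢; omega
    · intro c hc; ring
    · intro c hc; ring
    · intro c hc
      congr 3
      ring
  have hB : (jacobiTrudi (completeHom x (m + 1)) l u).det = B.det := by
    refine Matrix.det_eq_of_forall_row_eq_smul_add_pred
      (fun i => x m ^ (u i.succ + 1 - u i.castSucc).toNat) ?_ ?_
    · intro j
      simp only [jacobiTrudi, Matrix.of_apply, B, stripRange, Finset.sum_apply, Fin.cases_zero]
      rw [hshift]
      refine completeHom_succ_eq_sum x m ?_
      have := hl (Fin.zero_le j)
      simp only [Fin.val_zero, Nat.cast_zero]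
      omega
    · intro i j
      simp only [jacobiTrudi, Matrix.of_apply, B, stripRange, Finset.sum_apply, Fin.cases_succ]
      rw [hshift]
      have hi : u i.castSucc ≤ u i.succ := hu (Fin.castSucc_lt_succ).le
      have := completeHom_succ_eq_add x m
        (a := u i.castSucc + (i.castSucc : ℕ) - (l j + j))
        (k := u i.succ + (i.succ : ℕ) - (l j + j)) (by simp; omega)
      rw [this]
      have e1 : u i.castSucc + ((i.castSucc : ℕ) : ℤ) - (l j + j) + 1 =
        u i.castSucc + ((i.succ : ℕ) : ℤ) - (l j + j) := by simp; ring
      have e2 : u i.succ + ((i.succ : ℕ) : ℤ) - (l j + j) -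
        (u i.castSucc + ((i.castSucc : ℕ) : ℤ) - (l j + j)) =
          u i.succ + 1 - u i.castSucc := by simp; ring
      rw [e1, e2]
  rw [hB]
  have h1 := (Matrix.detRowAlternating (n := Fin (n + 1)) (R := R)).toMultilinearMap.map_sum_finset
    (fun i c => fun j => x m ^ (u i - c).toNat * completeHom x m ((c + i) - (l j + j)))
    (stripRange l u)
  refine h1.trans (Finset.sum_congr rfl fun v _ => ?_)
  exact Matrix.det_mul_column (fun i => x m ^ (u i - v i).toNat)
    (jacobiTrudi (completeHom x m) l v)

theorem det_jacobiTrudi_zero (x : ℕ → R) {l u : Fin (n + 1) → ℤ}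
    (hl : Monotone l) (hu : Monotone u) :
    (jacobiTrudi (completeHom x 0) l u).det = if u = l then 1 else 0 := by
  have hstrict {w : Fin (n + 1) → ℤ} (hw : Monotone w) :
      StrictMono fun i => w i + ((i : ℕ) : ℤ) := fun i j hij => by
    have h1 := hw hij.le
    have h2 : (i : ℕ) < j := hij
    simp only
    omega
  split_ifs with hul
  · subst hul
    rw [← Matrix.det_one (n := Fin (n + 1)) (R := R)]
    congr 1
    ext i j
    simp only [jacobiTrudi, completeHom, Matrix.of_apply, Matrix.one_apply, sub_eq_zero]
    simp only [(hstrict hu).injective.eq_iff (a := i) (b := j)]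
  · by_cases hsub : ∀ i, ∃ j, u i + ((i : ℕ) : ℤ) = l j + ((j : ℕ) : ℤ)
    · exfalso
      choose f hf using hsub
      have hfm : StrictMono f := fun i j hij => by
        have := hstrict hu hij
        simp only [hf] at this
        exact (hstrict hl).lt_iff_lt.1 this
      have hfid : f = id := by
        have := Subsingleton.elim (hfm.orderIsoOfSurjective f
          (Finite.surjective_of_injective hfm.injective)) (OrderIso.refl _)
        funext i
        exact congrArg (fun e : Fin (n + 1) ≃o Fin (n + 1) => e i) this
      apply hul
      funext i
      have := hf i
      simpa [hfid] using this
    · push Not at hsub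
      obtain ⟨i, hi⟩ := hsub
      refine Matrix.det_eq_zero_of_row_eq_zero i fun j => ?_
      simp [jacobiTrudi, completeHom, sub_eq_zero, hi j]

/-- Extend a filling by putting the new largest entry in all remaining boxes. -/
def extendFilling {l u v : Fin (n + 1) → ℤ} {m : ℕ} (g : rowDiagram l v → Fin m) :
    rowDiagram l u → Fin (m + 1) := fun b =>
  if h : b.1 ∈ rowDiagram l v then (g ⟨b.1, h⟩).castSucc else Fin.last m

theorem isSemistandard_extendFilling {l u v : Fin (n + 1) → ℤ} {m : ℕ}
    (hu : Monotone u) (hv : v ∈ Fintype.piFinset (stripRange l u))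
    {g : rowDiagram l v → Fin m} (hg : IsSemistandard g) :
    IsSemistandard (extendFilling (u := u) g) := by
  refine ⟨fun b b' hrow hcol => ?_, fun b b' hcol hrow => ?_⟩
  · have hb := mem_rowDiagram.1 b.2
    by_cases h' : b'.1 ∈ rowDiagram l v
    · have h : b.1 ∈ rowDiagram l v := by
        rw [mem_rowDiagram] at h' ⊢
        exact ⟨hb.1, by rw [hrow]; omega⟩
      simp only [extendFilling, h, h', dite_true]
      exact Fin.castSucc_le_castSucc_iff.2 (hg.1 _ _ hrow hcol)
    · simp only [extendFilling, h', dite_false]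
      exact Fin.le_last _
  · have hb := mem_rowDiagram.1 b.2
    have hb' := mem_rowDiagram.1 b'.2
    have h : b.1 ∈ rowDiagram l v := by
      have := le_of_lt_of_mem_stripRange hu hv hrow
      exact mem_rowDiagram.2 ⟨hb.1, by omega⟩
    by_cases h' : b'.1 ∈ rowDiagram l v
    · simp only [extendFilling, h, h', dite_true]
      exact Fin.castSucc_lt_castSucc_iff.2 (hg.2 _ _ hcol hrow)
    · simp only [extendFilling, h, h', dite_false, dite_true]
      exact Fin.castSucc_lt_last _

theorem le_of_extendFilling_eq {l u v w : Fin (n + 1) → ℤ} {m : ℕ}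
    {g : rowDiagram l v → Fin m} {g' : rowDiagram l w → Fin m} (hlv : l ≤ v) (hwu : w ≤ u)
    (h : extendFilling (u := u) g = extendFilling g') : w ≤ v := by
  intro i
  by_contra! hi
  have hb : (i, v i) ∈ rowDiagram l u := mem_rowDiagram.2 ⟨hlv i, hi.trans_le (hwu i)⟩
  have hb' : (i, v i) ∈ rowDiagram l w := mem_rowDiagram.2 ⟨hlv i, hi⟩
  have hb'' : (i, v i) ∉ rowDiagram l v := by simp [mem_rowDiagram]
  have := congrFun h ⟨_, hb⟩
  simp only [extendFilling, hb', hb'', dite_true, dite_false] at this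
  exact (Fin.castSucc_lt_last _).ne' this

theorem extendFilling_injective {l u v : Fin (n + 1) → ℤ} {m : ℕ} (hvu : v ≤ u) :
    Function.Injective
      (extendFilling : (rowDiagram l v → Fin m) → rowDiagram l u → Fin (m + 1)) := by
  intro g g' h
  funext b
  have hb := mem_rowDiagram.1 b.2
  have := congrFun h ⟨b.1, mem_rowDiagram.2 ⟨hb.1, hb.2.trans_le (hvu _)⟩⟩
  simpa [extendFilling] using this

theorem prod_extendFilling (x : ℕ → R) {l u v : Fin (n + 1) → ℤ} {m : ℕ}
    (hlv : l ≤ v) (hvu : v ≤ u) (g : rowDiagram l v → Fin m) :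
    ∏ b, x (extendFilling (u := u) g b) =
      (∏ i, x m ^ (u i - v i).toNat) * ∏ b, x (g b) := by
  let G : Fin (n + 1) × ℤ → R := fun b =>
    if h : b ∈ rowDiagram l v then x (g ⟨b, h⟩) else x m
  have hG : ∀ b, x (extendFilling (u := u) g b) = G b.1 := fun b => by
    by_cases h : b.1 ∈ rowDiagram l v <;> simp [extendFilling, G, h]
  have hG' : ∀ b, x (g b) = G b.1 := fun b => by simp [G]
  have hsub : rowDiagram l v ⊆ rowDiagram l u := fun b hb => by
    rw [mem_rowDiagram] at hb ⊢
    exact ⟨hb.1, hb.2.trans_le (hvu _)⟩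
  simp only [hG, hG']
  rw [Finset.prod_coe_sort (rowDiagram l u) G, Finset.prod_coe_sort (rowDiagram l v) G,
    ← Finset.prod_sdiff hsub]
  congr 1
  rw [Finset.prod_finset_product (rowDiagram l u \ rowDiagram l v) Finset.univ
    (fun i => Finset.Ico (v i) (u i))]
  · refine Finset.prod_congr rfl fun i _ => ?_
    rw [← Int.card_Ico, ← Finset.prod_const]
    refine Finset.prod_congr rfl fun c hc => ?_
    have : (i, c) ∉ rowDiagram l v := by
      simp only [Finset.mem_Ico] at hc
      simp [mem_rowDiagram, hc.1]
    simp [G, this]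
  · intro b
    have hb : l b.1 ≤ v b.1 := hlv b.1
    simp only [Finset.mem_sdiff, mem_rowDiagram, Finset.mem_univ, true_and, Finset.mem_Ico]
    omega

theorem exists_extendFilling_eq {l u : Fin (n + 1) → ℤ} {m : ℕ} (hl : Monotone l)
    (hu : Monotone u) (hlu : l ≤ u) {g : rowDiagram l u → Fin (m + 1)}
    (hg : IsSemistandard g) :
    ∃ v ∈ Fintype.piFinset (stripRange l u), l ≤ v ∧
      ∃ g' : rowDiagram l v → Fin m, IsSemistandard g' ∧ extendFilling g' = g := by
  have hrow (i : Fin (n + 1)) : ∃ c, l i ≤ c ∧ c ≤ u i ∧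
      ∀ (d : ℤ) (h : (i, d) ∈ rowDiagram l u), d < c ↔ g ⟨(i, d), h⟩ ≠ Fin.last m := by
    let F := (Finset.Ico (l i) (u i)).filter fun d =>
      ∃ h : (i, d) ∈ rowDiagram l u, g ⟨(i, d), h⟩ = Fin.last m
    by_cases hF : F.Nonempty
    · have hmin := F.min'_mem hF
      obtain ⟨hmin1, hmin2, hmin3⟩ := Finset.mem_filter.1 hmin
      have hmem := Finset.mem_Ico.1 hmin1
      refine ⟨F.min' hF, hmem.1, hmem.2.le, fun d h => ⟨fun hd hlast => ?_, fun hd => ?_⟩⟩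
      · exact absurd (F.min'_le d (Finset.mem_filter.2
          ⟨Finset.mem_Ico.2 (mem_rowDiagram.1 h), h, hlast⟩)) (not_le.2 hd)
      · by_contra! hle
        have := hg.1 ⟨_, hmin2⟩ ⟨_, h⟩ rfl hle
        rw [hmin3] at this
        exact hd (Fin.last_le_iff.1 this)
    · refine ⟨u i, hlu i, le_rfl, fun d h => ⟨fun _ hlast => hF ⟨d, ?_⟩, fun _ => ?_⟩⟩
      · exact Finset.mem_filter.2 ⟨Finset.mem_Ico.2 (mem_rowDiagram.1 h), h, hlast⟩
      · exact (mem_rowDiagram.1 h).2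
  choose v hlv hvu hv using hrow
  have hsub : ∀ b ∈ rowDiagram l v, b ∈ rowDiagram l u := fun b hb => by
    rw [mem_rowDiagram] at hb ⊢
    exact ⟨hb.1, hb.2.trans_le (hvu _)⟩
  have hne : ∀ (b : _) (hb : b ∈ rowDiagram l v), g ⟨b, hsub b hb⟩ ≠ Fin.last m :=
    fun b hb => (hv b.1 b.2 (hsub b hb)).1 (mem_rowDiagram.1 hb).2
  refine ⟨v, ?_, hlv, fun b => (g ⟨b.1, hsub _ b.2⟩).castPred (hne _ b.2), ⟨?_, ?_⟩, ?_⟩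
  · rw [Fintype.mem_piFinset]
    intro i
    refine Finset.mem_Icc.2 ⟨?_, hvu i⟩
    induction i using Fin.cases with
    | zero => exact hlv 0
    | succ i =>
      by_contra! hlt
      simp only [Fin.cases_succ] at hlt
      have hlow := hl (Fin.castSucc_lt_succ (i := i)).le
      have hupp := hu (Fin.castSucc_lt_succ (i := i)).le
      have hli := hlv i.succ
      have hb : (i.succ, v i.succ) ∈ rowDiagram l u :=
        mem_rowDiagram.2 ⟨hli, hlt.trans_le hupp⟩
      have hb' : (i.castSucc, v i.succ) ∈ rowDiagram l u :=
        mem_rowDiagram.2 ⟨hlow.trans hli, hlt⟩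
      have h1 := hg.2 ⟨_, hb⟩ ⟨_, hb'⟩ rfl Fin.castSucc_lt_succ
      exact lt_irrefl _ ((hv _ _ hb).2 (ne_of_lt (h1.trans_le (Fin.le_last _))))
  · intro b b' h1 h2
    exact Fin.castPred_le_castPred_iff.2 (hg.1 _ _ h1 h2)
  · intro b b' h1 h2
    exact Fin.castPred_lt_castPred_iff.2 (hg.2 _ _ h1 h2)
  · funext b
    have hb := mem_rowDiagram.1 b.2
    by_cases h : b.1 ∈ rowDiagram l v
    · simp [extendFilling, h]
    · simp only [extendFilling, h, dite_false]
      by_contra hlast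
      exact h (mem_rowDiagram.2 ⟨hb.1, (hv _ _ b.2).2 fun e => hlast e.symm⟩)

theorem semistandardSum_succ (x : ℕ → R) (m : ℕ) {l u : Fin (n + 1) → ℤ}
    (hl : Monotone l) (hu : Monotone u) (hlu : l ≤ u) :
    semistandardSum x (rowDiagram l u) (m + 1) =
      ∑ v ∈ (Fintype.piFinset (stripRange l u)).filter (fun v => l ≤ v),
        (∏ i, x m ^ (u i - v i).toNat) * semistandardSum x (rowDiagram l v) m := by
  simp only [semistandardSum, Finset.mul_sum]
  rw [Finset.sum_sigma']
  symm
  refine Finset.sum_bij (fun p _ => extendFilling p.2) ?_ ?_ ?_ ?_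
  · rintro ⟨v, g⟩ h
    simp only [Finset.mem_sigma, Finset.mem_filter, Finset.mem_univ, true_and] at h ⊢
    exact isSemistandard_extendFilling hu h.1.1 h.2
  · rintro ⟨v, g⟩ h ⟨w, g'⟩ h' heq
    simp only [Finset.mem_sigma, Finset.mem_filter, Finset.mem_univ, true_and] at h h' heq
    have hvw : v = w := le_antisymm
      (le_of_extendFilling_eq h'.1.2 (le_of_mem_stripRange h.1.1) heq.symm)
      (le_of_extendFilling_eq h.1.2 (le_of_mem_stripRange h'.1.1) heq)
    subst hvw
    rw [extendFilling_injective (le_of_mem_stripRange h.1.1) heq]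
  · intro g hg
    simp only [Finset.mem_filter, Finset.mem_univ, true_and] at hg
    obtain ⟨v, hv, hlv, g', hg', rfl⟩ := exists_extendFilling_eq hl hu hlu hg
    exact ⟨⟨v, g'⟩, by simp [hv, hlv, hg'], rfl⟩
  · rintro ⟨v, g⟩ h
    simp only [Finset.mem_sigma, Finset.mem_filter, Finset.mem_univ, true_and] at h
    exact (prod_extendFilling x h.1.2 (le_of_mem_stripRange h.1.1) g).symm

theorem semistandardSum_zero (x : ℕ → R) {l u : Fin (n + 1) → ℤ} (hlu : l ≤ u) :
    semistandardSum x (rowDiagram l u) 0 = if u = l then 1 else 0 := by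
  split_ifs with h
  · subst h
    have : IsEmpty (rowDiagram u u) := ⟨fun b => by
      have := mem_rowDiagram.1 b.2
      omega⟩
    simp [semistandardSum, IsSemistandard]
  · obtain ⟨i, hi⟩ : ∃ i, l i < u i := by
      by_contra! hle
      exact h (le_antisymm hle hlu)
    have hb : (i, l i) ∈ rowDiagram l u := mem_rowDiagram.2 ⟨le_rfl, hi⟩
    have : IsEmpty (rowDiagram l u → Fin 0) := ⟨fun g => (g ⟨_, hb⟩).elim0⟩
    simp [semistandardSum]

/-- The Jacobi–Trudi identity. -/
theorem det_jacobiTrudi (x : ℕ → R) (m : ℕ) {l u : Fin (n + 1) → ℤ}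
    (hl : Monotone l) (hu : Monotone u) :
    (jacobiTrudi (completeHom x m) l u).det =
      if l ≤ u then semistandardSum x (rowDiagram l u) m else 0 := by
  induction m generalizing u with
  | zero =>
    rw [det_jacobiTrudi_zero x hl hu]
    by_cases hlu : l ≤ u
    · rw [if_pos hlu, semistandardSum_zero x hlu]
    · rw [if_neg hlu, if_neg fun h => hlu h.ge]
  | succ m ih =>
    have hsum : (jacobiTrudi (completeHom x (m + 1)) l u).det =
        ∑ v ∈ (Fintype.piFinset (stripRange l u)).filter (fun v => l ≤ v),
          (∏ i, x m ^ (u i - v i).toNat) * semistandardSum x (rowDiagram l v) m := by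
      rw [det_jacobiTrudi_succ x m hl hu, Finset.sum_filter]
      refine Finset.sum_congr rfl fun v hv => ?_
      rw [ih (monotone_of_mem_stripRange hu hv), mul_ite, mul_zero]
    rw [hsum]
    split_ifs with hlu
    · rw [semistandardSum_succ x m hl hu hlu]
    · refine Finset.sum_eq_zero fun v hv => absurd ?_ hlu
      obtain ⟨hv, hlv⟩ := Finset.mem_filter.1 hv
      exact hlv.trans (le_of_mem_stripRange hv)

end JacobiTrudi

section ToeplitzMinor

variable {R : Type*} [CommRing R]

/-- The alternating sum in the expansion along the row `a` of a minor of a Toeplitz matrix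
with columns `J`, where `f` gives the complementary minors. -/
def rowExpansion (h : ℤ → R) (a : ℤ) : (List ℤ → R) → List ℤ → R
  | _, [] => 0
  | f, b :: J => h (a - b) * f J - rowExpansion h a (fun K => f (b :: K)) J

/-- The minor of the Toeplitz matrix `h (a - b)` with rows `I` and columns `J`. -/
def toeplitzMinor (h : ℤ → R) : List ℤ → List ℤ → R
  | [], _ => 1
  | a :: I, J => rowExpansion h a (toeplitzMinor h I) J

theorem rowExpansion_eq_sum (h : ℤ → R) (a : ℤ) (f : List ℤ → R) (J : List ℤ) :
    rowExpansion h a f J =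
      ∑ j : Fin J.length, (-1) ^ (j : ℕ) * h (a - J.get j) * f (J.eraseIdx j) := by
  induction J generalizing f with
  | nil => simp [rowExpansion]
  | cons b J ih =>
    rw [rowExpansion, ih]
    simp only [List.length_cons]
    rw [Fin.sum_univ_succ]
    simp [pow_succ, sub_eq_add_neg]

theorem det_eq_toeplitzMinor (h : ℤ → R) (n : ℕ) (I J : List ℤ) (hI : I.length = n)
    (hJ : J.length = n) :
    (Matrix.of fun i j : Fin n => h (I.get (i.cast hI.symm) - J.get (j.cast hJ.symm))).det =
      toeplitzMinor h I J := by
  induction n generalizing I J with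
  | zero =>
    obtain rfl := List.length_eq_zero_iff.1 hI
    simp [toeplitzMinor]
  | succ n ih =>
    obtain ⟨a, I, rfl⟩ := List.exists_cons_of_length_eq_add_one hI
    rw [toeplitzMinor, rowExpansion_eq_sum, Matrix.det_succ_row_zero,
      ← (finCongr hJ).sum_comp]
    refine Finset.sum_congr rfl fun j _ => ?_
    rw [← ih I (J.eraseIdx j) (by simpa using hI)
      (by rw [List.length_eraseIdx_of_lt j.2, hJ, Nat.add_sub_cancel])]
    congr 2
    ext i k
    simp only [Matrix.submatrix_apply, Matrix.of_apply, List.get_eq_getElem, Fin.val_cast,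
      Fin.val_succ, List.getElem_cons_succ, List.getElem_eraseIdx]
    congr 2
    rcases lt_or_ge (k : ℕ) j with hk | hk
    · rw [dif_pos hk]
      congr 1
      rw [Fin.succAbove_of_castSucc_lt _ _ (by simpa [Fin.lt_def] using hk), Fin.val_castSucc]
    · rw [dif_neg (not_lt.2 hk)]
      congr 1
      rw [Fin.succAbove_of_le_castSucc _ _ (by simpa [Fin.le_def] using hk), Fin.val_succ]

theorem toeplitzMinor_cons (h : ℤ → R) (a : ℤ) (I J : List ℤ) :
    toeplitzMinor h (a :: I) J = rowExpansion h a (toeplitzMinor h I) J := rfl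

set_option linter.unusedSimpArgs false in
set_option maxHeartbeats 4000000 in
theorem toeplitzMinor_eq (h : ℤ → R) (hneg : ∀ k < 0, h k = 0) (h0 : h 0 = 1) :
    toeplitzMinor h [-7, -6, -3, -2, -1, 3, 4, 7, 8] [-9, -8, -6, -4, -3, -1, 1, 4, 6] =
      toeplitzMinor h [-7, -6, -2, -1, 2, 3, 4, 7, 8] [-9, -8, -6, -4, -1, 1, 2, 4, 6] := by
  have hneg' (k : ℕ) [k.AtLeastTwo] : h (-OfNat.ofNat k) = 0 :=
    hneg _ (neg_lt_zero.2 (by simp))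
  have hneg1 : h (-1) = 0 := hneg _ (by norm_num)
  simp only [toeplitzMinor_cons h (-7), rowExpansion, h0, hneg1, hneg', Int.reduceAdd, Int.reduceSub,
    Int.reduceNeg, zero_mul, one_mul, sub_zero, zero_sub, sub_neg_eq_add]
  simp only [toeplitzMinor_cons h (-6), rowExpansion, h0, hneg1, hneg', Int.reduceAdd, Int.reduceSub,
    Int.reduceNeg, zero_mul, one_mul, sub_zero, zero_sub, sub_neg_eq_add]
  simp only [toeplitzMinor_cons h (-3), rowExpansion, h0, hneg1, hneg', Int.reduceAdd, Int.reduceSub,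
    Int.reduceNeg, zero_mul, one_mul, sub_zero, zero_sub, sub_neg_eq_add]
  simp only [toeplitzMinor_cons h (-2), rowExpansion, h0, hneg1, hneg', Int.reduceAdd, Int.reduceSub,
    Int.reduceNeg, zero_mul, one_mul, sub_zero, zero_sub, sub_neg_eq_add]
  simp only [toeplitzMinor_cons h (-1), rowExpansion, h0, hneg1, hneg', Int.reduceAdd, Int.reduceSub,
    Int.reduceNeg, zero_mul, one_mul, sub_zero, zero_sub, sub_neg_eq_add]
  simp only [toeplitzMinor_cons h 2, rowExpansion, h0, hneg1, hneg', Int.reduceAdd, Int.reduceSub,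
    Int.reduceNeg, zero_mul, one_mul, sub_zero, zero_sub, sub_neg_eq_add]
  simp only [toeplitzMinor_cons h 3, rowExpansion, h0, hneg1, hneg', Int.reduceAdd, Int.reduceSub,
    Int.reduceNeg, zero_mul, one_mul, sub_zero, zero_sub, sub_neg_eq_add]
  simp only [toeplitzMinor_cons h 4, rowExpansion, h0, hneg1, hneg', Int.reduceAdd, Int.reduceSub,
    Int.reduceNeg, zero_mul, one_mul, sub_zero, zero_sub, sub_neg_eq_add]
  simp only [toeplitzMinor_cons h 7, rowExpansion, h0, hneg1, hneg', Int.reduceAdd, Int.reduceSub,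
    Int.reduceNeg, zero_mul, one_mul, sub_zero, zero_sub, sub_neg_eq_add]
  simp only [toeplitzMinor_cons h 8, rowExpansion, h0, hneg1, hneg', Int.reduceAdd, Int.reduceSub,
    Int.reduceNeg, zero_mul, one_mul, sub_zero, zero_sub, sub_neg_eq_add]
  simp only [toeplitzMinor, mul_one]
  generalize h 1 = h1
  generalize h 2 = h2
  generalize h 3 = h3
  generalize h 4 = h4
  generalize h 5 = h5
  generalize h 6 = h6
  generalize h 7 = h7
  generalize h 8 = h8
  generalize h 9 = h9
  generalize h 10 = h10
  generalize h 11 = h11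
  generalize h 12 = h12
  generalize h 13 = h13
  generalize h 14 = h14
  generalize h 15 = h15
  generalize h 16 = h16
  generalize h 17 = h17
  ring

end ToeplitzMinor

/-- The Young diagram with the given row lengths. -/
def youngDiagramOf (rows : List ℕ) : Finset Box :=
  (Finset.range rows.length).biUnion fun i =>
    (Finset.range (rows.getD i 0)).image fun c : ℕ => ((i : ℤ), (c : ℤ))

theorem mem_youngDiagramOf {rows : List ℕ} {b : Box} :
    b ∈ youngDiagramOf rows ↔ 0 ≤ b.1 ∧ 0 ≤ b.2 ∧ b.2 < rows.getD b.1.toNat 0 := by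
  obtain ⟨r, c⟩ := b
  simp only [youngDiagramOf, Finset.mem_biUnion, Finset.mem_range, Finset.mem_image,
    Prod.mk.injEq]
  constructor
  · rintro ⟨i, hi, d, hd, rfl, rfl⟩
    simp only [Int.toNat_natCast]
    omega
  · rintro ⟨hr, hc, h⟩
    refine ⟨r.toNat, ?_, c.toNat, by omega, by omega, by omega⟩
    by_contra! hlen
    rw [List.getD_eq_default _ _ hlen] at h
    simp only [Nat.cast_zero] at h
    omega

theorem isYoungDiagram_youngDiagramOf {rows : List ℕ} (h : rows.Pairwise (· ≥ ·)) :
    IsYoungDiagram (youngDiagramOf rows) := by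
  have hanti {i j : ℕ} (hij : i ≤ j) : rows.getD j 0 ≤ rows.getD i 0 := by
    rcases lt_or_ge j rows.length with hj | hj
    · rw [List.getD_eq_getElem _ _ hj, List.getD_eq_getElem _ _ (hij.trans_lt hj)]
      rcases hij.eq_or_lt with rfl | hlt
      · exact le_rfl
      · exact List.pairwise_iff_getElem.1 h i j _ hj hlt
    · rw [List.getD_eq_default _ _ hj]
      exact Nat.zero_le _
  intro b hb
  obtain ⟨h1, h2, h3⟩ := mem_youngDiagramOf.1 hb
  refine ⟨h1, h2, fun b' h1' h2' hr hc => mem_youngDiagramOf.2 ⟨h1', h2', ?_⟩⟩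
  have := hanti (Int.toNat_le_toNat hr)
  omega

theorem isShape_of_rows {S : Finset Box} (t : Box) (mu lam : List ℕ)
    (hmu : mu.Pairwise (· ≥ ·)) (hlam : lam.Pairwise (· ≥ ·))
    (hsub : youngDiagramOf mu ⊆ youngDiagramOf lam)
    (hS : S = translateS t (youngDiagramOf lam \ youngDiagramOf mu)) : IsShape S :=
  ⟨t, _, ⟨_, _, isYoungDiagram_youngDiagramOf hmu, isYoungDiagram_youngDiagramOf hlam,
    hsub, rfl⟩, hS⟩

/-- Adding a box adjacent to a connected set of boxes gives a connected set. -/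
theorem isConnectedShape_insert {S : Finset Box} {b : Box} (hS : IsConnectedShape S)
    (h : ∃ c ∈ S, AdjB b c) : IsConnectedShape (insert b S) := by
  obtain ⟨c, hc, hbc⟩ := h
  have hcb : AdjB c b := by
    unfold AdjB at hbc ⊢
    omega
  have hlift {x y : Box} (hx : x ∈ S) (hy : y ∈ S) : Relation.ReflTransGen
      (fun a b' => a ∈ insert b S ∧ b' ∈ insert b S ∧ AdjB a b') x y :=
    Relation.ReflTransGen.mono (fun _ _ h =>
      ⟨Finset.mem_insert_of_mem h.1, Finset.mem_insert_of_mem h.2.1, h.2.2⟩) _ _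
      (hS.2 x hx y hy)
  have hb := Finset.mem_insert_self b S
  have hc' := Finset.mem_insert_of_mem (b := b) hc
  refine ⟨Finset.insert_nonempty b S, fun x hx y hy => ?_⟩
  rcases Finset.mem_insert.1 hx with hxb | hxS <;> rcases Finset.mem_insert.1 hy with hyb | hyS
  · rw [hxb, hyb]
  · rw [hxb]
    exact .head ⟨hb, hc', hbc⟩ (hlift hc hyS)
  · rw [hyb]
    exact .tail (hlift hxS hc) ⟨hc', hb, hcb⟩
  · exact hlift hxS hyS

theorem isConnectedShape_singleton (b : Box) : IsConnectedShape {b} := by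
  refine ⟨Finset.singleton_nonempty b, fun x hx y hy => ?_⟩
  rw [Finset.mem_singleton.1 hx, Finset.mem_singleton.1 hy]

instance : DecidableRel AdjB := fun x y => by
  unfold AdjB
  infer_instance

theorem isConnectedShape_Wlow10 : IsConnectedShape Wlow10 :=
  isConnectedShape_insert (isConnectedShape_singleton _) (by decide)

theorem isConnectedShape_Wup10 : IsConnectedShape Wup10 :=
  isConnectedShape_insert (isConnectedShape_singleton _) (by decide)

theorem isConnectedShape_gamma10_sdiff_Wup10 : IsConnectedShape (gamma10 \ Wup10) := by
  have h : gamma10 \ Wup10 =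
      {(0, 2), (1, 2), (1, 1), (2, 1), (2, 0), (3, 0), (3, 1)} := by decide
  rw [h]
  iterate 6 refine isConnectedShape_insert ?_ (by decide)
  exact isConnectedShape_singleton _

theorem isConnectedShape_gamma10_sdiff_Wlow10 : IsConnectedShape (gamma10 \ Wlow10) := by
  have h : gamma10 \ Wlow10 =
      {(0, 3), (0, 2), (1, 3), (1, 2), (1, 1), (2, 1), (3, 1)} := by decide
  rw [h]
  iterate 6 refine isConnectedShape_insert ?_ (by decide)
  exact isConnectedShape_singleton _

theorem isSWBox_gamma10 : IsSWBox gamma10 (3, 0) := by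
  unfold IsSWBox
  decide

theorem isNEBox_gamma10 : IsNEBox gamma10 (0, 3) := by
  unfold IsNEBox
  decide

theorem isSWBox_O10 : IsSWBox O10 (3, 1) := by
  unfold IsSWBox
  decide

theorem isNEBox_O10 : IsNEBox O10 (0, 2) := by
  unfold IsNEBox
  decide

theorem isNEBox_unique {S : Finset Box} {b b' : Box} (hb : IsNEBox S b) (hb' : IsNEBox S b') :
    b = b' := by
  have h1 := le_antisymm (hb.2.1 b' hb'.1) (hb'.2.1 b hb.1)
  exact Prod.ext h1 (le_antisymm (hb'.2.2 b hb.1 h1) (hb.2.2 b' hb'.1 h1.symm))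

/-- The two copies of `W` in `gamma10` cannot be enlarged along their diagonals. -/
theorem Wlow10_maximal {W' Wlow' Wup' : Finset Box} (hbot : LiesInBottomAt W' gamma10 Wlow')
    (htop : LiesInTopAt W' gamma10 Wup') (hsub : Wlow10 ⊆ Wlow')
    (hdiag : DiagSet Wlow' = DiagSet Wlow10) : Wlow' = Wlow10 := by
  obtain ⟨⟨t, ht⟩, hlow, -⟩ := hbot
  obtain ⟨⟨t', ht'⟩, hup, -, b, hb, hbmem⟩ := htop
  have hcand : ∀ p ∈ gamma10, diagB p ∈ DiagSet Wlow10 → p ∈ Wlow10 ∨ p = (3, 1) := by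
    decide
  have hmem (p : Box) (hp : p ∈ Wlow') : p ∈ Wlow10 ∨ p = (3, 1) :=
    hcand p (hlow hp) (hdiag ▸ Finset.mem_image_of_mem diagB hp)
  by_cases h31 : ((3, 1) : Box) ∈ Wlow'
  · exfalso
    have hshift (p : Box) (hp : p ∈ Wlow') : t' - t + p ∈ gamma10 := by
      rw [ht, translateS, Finset.mem_image] at hp
      obtain ⟨q, hq, rfl⟩ := hp
      refine hup ?_
      rw [ht', translateS, Finset.mem_image]
      exact ⟨q, hq, by abel⟩
    obtain rfl := isNEBox_unique hb isNEBox_gamma10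
    rw [ht', translateS, Finset.mem_image] at hbmem
    obtain ⟨q, hq, hqb⟩ := hbmem
    have hq' : t + q ∈ Wlow' := by
      rw [ht]
      exact Finset.mem_image_of_mem _ hq
    have hd : t' - t = (0, 3) - (t + q) := by
      rw [← hqb]
      abel
    rw [hd] at hshift
    have h20 := hshift (2, 0) (hsub (by decide))
    have h31' := hshift (3, 1) h31
    have hall : ∀ p ∈ insert ((3, 1) : Box) Wlow10,
        (0, 3) - p + (2, 0) ∈ gamma10 → (0, 3) - p + (3, 1) ∈ gamma10 → False := by
      decide
    exact hall (t + q) (Finset.mem_insert.2 (hmem _ hq').symm) h20 h31'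
  · refine Finset.Subset.antisymm (fun p hp => ?_) hsub
    rcases hmem p hp with h | rfl
    · exact h
    · exact absurd hp h31

theorem isWOW_gamma10 : IsWOW true gamma10 W10 O10 Wlow10 Wup10 v10 := by
  refine ⟨?_, ?_, ?_, ?_, by decide, ?_, isConnectedShape_gamma10_sdiff_Wup10, ?_,
    isConnectedShape_gamma10_sdiff_Wlow10, rfl, ⟨0, by decide, by decide⟩, ?_,
    fun W' Wlow' Wup' hbot htop _ _ hsub hdiag => Wlow10_maximal hbot htop hsub hdiag⟩
  · exact isShape_of_rows (0, 0) [2, 1] [4, 4, 2, 2]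
      (by decide) (by decide) (by decide) (by decide)
  · exact isShape_of_rows (0, 0) [] [1, 1] (by decide) (by decide) (by decide) (by decide)
  · exact ⟨⟨(2, 0), by decide⟩, by decide, isConnectedShape_Wlow10, _, isSWBox_gamma10,
      by decide⟩
  · exact ⟨⟨(0, 3), by decide⟩, by decide, isConnectedShape_Wup10, _, isNEBox_gamma10,
      by decide⟩
  · exact isShape_of_rows (0, 0) [2, 1] [3, 3, 2, 2]
      (by decide) (by decide) (by decide) (by decide)
  · exact isShape_of_rows (0, 0) [2, 1, 1, 1] [4, 4, 2, 2]
      (by decide) (by decide) (by decide) (by decide)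
  · exact ⟨⟨_, isSWBox_O10, by decide⟩, ⟨_, isNEBox_O10, by decide⟩⟩

section SchurPoly

/-- The variables of a polynomial ring in `m` variables, continued by zero. -/
def schurVars (m : ℕ) (k : ℕ) : MvPolynomial (Fin m) ℚ :=
  if h : k < m then MvPolynomial.X ⟨k, h⟩ else 0

theorem schurPoly_image {n : ℕ} (S : Finset (Fin (n + 1) × ℤ)) (r : ℤ) (m : ℕ) :
    schurPoly (S.image fun b => ((r - ((b.1 : ℕ) : ℤ), b.2) : Box)) m =
      semistandardSum (schurVars m) S m := by
  set φ : Fin (n + 1) × ℤ → Box := fun b => (r - ((b.1 : ℕ) : ℤ), b.2) with hφ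
  have hinj : Function.Injective φ := fun b b' h => by
    simp only [hφ, Prod.mk.injEq, sub_right_inj, Nat.cast_inj, Fin.val_inj] at h
    exact Prod.ext h.1 h.2
  let e : S ≃ S.image φ := Equiv.ofBijective
    (fun b => ⟨φ b.1, Finset.mem_image_of_mem φ b.2⟩)
    ⟨fun b b' h => Subtype.ext (hinj (congrArg Subtype.val h)), fun ⟨b, hb⟩ => by
      obtain ⟨b', hb', rfl⟩ := Finset.mem_image.1 hb
      exact ⟨⟨b', hb'⟩, rfl⟩⟩
  have he (b : S) : (e b : Box) = (r - ((b.1.1 : ℕ) : ℤ), b.1.2) := rfl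
  unfold schurPoly semistandardSum
  refine Finset.sum_equiv (Equiv.arrowCongr e.symm (Equiv.refl (Fin m))) (fun g => ?_)
    fun g _ => ?_
  · rw [Finset.mem_filter, Finset.mem_filter]
    refine and_congr (iff_of_true (Finset.mem_univ _) (Finset.mem_univ _)) ?_
    simp only [e.surjective.forall, he, sub_right_inj, Nat.cast_inj, Fin.val_inj,
      sub_lt_sub_iff_left, Nat.cast_lt, Fin.val_fin_lt]
    exact Iff.rfl
  · rw [← e.prod_comp]
    simp [schurVars]

theorem schurPoly_eq_det {n : ℕ} {S : Finset Box} (r : ℤ) {l u : Fin (n + 1) → ℤ}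
    (hl : Monotone l) (hu : Monotone u) (hlu : l ≤ u)
    (hS : S = (rowDiagram l u).image fun b => ((r - ((b.1 : ℕ) : ℤ), b.2) : Box)) (m : ℕ) :
    schurPoly S m = (jacobiTrudi (completeHom (schurVars m) m) l u).det := by
  rw [det_jacobiTrudi _ _ hl hu, if_pos hlu, hS, schurPoly_image]

theorem schurPoly_compose_beta21 (m : ℕ) :
    schurPoly (composeWOW true gamma10 v10 beta21) m =
      toeplitzMinor (completeHom (schurVars m) m)
        [-7, -6, -3, -2, -1, 3, 4, 7, 8] [-9, -8, -6, -4, -3, -1, 1, 4, 6] := by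
  rw [schurPoly_eq_det 6 (l := ![-2, -2, -1, 0, 0, 1, 2, 4, 5])
    (u := ![0, 0, 2, 2, 2, 5, 5, 7, 7]) (by decide) (by decide)
    (Pi.le_def.2 (by decide)) (by decide),
    ← det_eq_toeplitzMinor _ 9 _ _ rfl rfl]
  congr 1
  refine Matrix.ext fun i j => ?_
  simp only [jacobiTrudi, Matrix.of_apply]
  refine congrArg (completeHom (schurVars m) m) ?_
  revert i j
  decide

theorem schurPoly_compose_rot180_beta21 (m : ℕ) :
    schurPoly (composeWOW true gamma10 v10 (rot180 beta21)) m =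
      toeplitzMinor (completeHom (schurVars m) m)
        [-7, -6, -2, -1, 2, 3, 4, 7, 8] [-9, -8, -6, -4, -1, 1, 2, 4, 6] := by
  rw [schurPoly_eq_det 5 (l := ![-3, -3, -2, -1, 1, 2, 2, 3, 4])
    (u := ![-1, -1, 2, 2, 4, 4, 4, 6, 6]) (by decide) (by decide)
    (Pi.le_def.2 (by decide)) (by decide),
    ← det_eq_toeplitzMinor _ 9 _ _ rfl rfl]
  congr 1
  refine Matrix.ext fun i j => ?_
  simp only [jacobiTrudi, Matrix.of_apply]
  refine congrArg (completeHom (schurVars m) m) ?_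
  revert i j
  decide

end SchurPoly

/-- the example beyond McNamara–van Willigenburg.
With `β = (2,1)`, `W = (1,1)`, `O = (2,2,1,1)/(1)` and `γ = (4,4,2,2)/(2,1)`,
`γ` is a `W→O→W` shape and `β ∘_W γ ∼ β* ∘_W γ`. -/
theorem statement10 :
    IsWOW true gamma10 W10 O10 Wlow10 Wup10 v10 ∧
    (∃ u : Box, O10 = translateS u Oabs10) ∧
    SchurEquiv (composeWOW true gamma10 v10 beta21)
      (composeWOW true gamma10 v10 (rot180 beta21)) := by
  refine ⟨isWOW_gamma10, ⟨(0, 1), by decide⟩, fun m => ?_⟩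
  rw [schurPoly_compose_beta21, schurPoly_compose_rot180_beta21]
  exact toeplitzMinor_eq _ (fun _ => completeHom_of_neg _ m) (completeHom_zero_right _ m)
end
end
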